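/- arXiv:2103.07975 — 5 statements merged into one kernel-verified Lean document; each statement's English description precedes it below -/
import Mathlib

section
/- Newton's theorem for the periodic Coulomb potential: let L > 0, let R > 0 be such that the closed ball B_R (centered at 0) is contained in C_L = (−L/2, L/2)², and let ρ : ℝ² → ℝ be a bounded measurable radial function (ρ(x) depends only on |x|) supported in B_R with ∫ρ dx = 0. Then the periodic convolution (ρ ∗ G_L)(x) = ∫ ρ(y) G_L(x−y) dy is almost everywhere equal to a constant on C_L ∖ B_R. Consequently, for any bounded measurable ρ′ : ℝ² → ℝ supported in C_L ∖ B_R with ∫ρ′ dx = 0, the interaction vanishes: ∬ G_L(x−y) ρ(x) ρ′(y) dx dy = 0. -/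
open MeasureTheory Real Filter Finset Topology Metric Bornology
open scoped RealInnerProductSpace ENNReal

noncomputable section

/-- The Euclidean plane. -/
abbrev E2 : Type := EuclideanSpace ℝ (Fin 2)

/-- The open square `C_ℓ = (−ℓ/2, ℓ/2)²`. -/
def cube (ℓ : ℝ) : Set E2 := {x : E2 | ∀ i, x i ∈ Set.Ioo (-(ℓ/2)) (ℓ/2)}

/-- The 2D Jellium energy of points `x₁, …, x_N` with uniform background on `Ω`. -/
def EJel {N : ℕ} (Ω : Set E2) (x : Fin N → E2) : ℝ :=
    -(∑ j : Fin N, ∑ k ∈ Finset.Ioi j, Real.log ‖x j - x k‖)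
    + ∑ j : Fin N, ∫ y in Ω, Real.log ‖x j - y‖
    - (1/2) * ∫ p in Ω, ∫ q in Ω, Real.log ‖p - q‖

/-- The lattice point of `ℤ² ⊂ ℝ²` with coordinates `k`. -/
def latVec (k : ℤ × ℤ) : E2 := (WithLp.equiv 2 (Fin 2 → ℝ)).symm ![(k.1 : ℝ), (k.2 : ℝ)]

/-- Coordinatewise Laplacian of a function on `ℝ²`. -/
def lap (φ : E2 → ℝ) (x : E2) : ℝ :=
  ∑ i : Fin 2, iteratedDeriv 2 (fun t : ℝ => φ (x + t • EuclideanSpace.single i (1:ℝ))) 0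

/-- `G` is the `ℓℤ²`-periodic Coulomb potential: the mean-zero `ℓℤ²`-periodic (locally
integrable) distributional solution of `−ΔG = 2π(Σ_{z∈ℓℤ²} δ_z − ℓ⁻²)`. -/
structure IsPeriodicCoulomb (ℓ : ℝ) (G : E2 → ℝ) : Prop where
  periodic : ∀ x : E2, ∀ k : ℤ × ℤ, G (x + ℓ • latVec k) = G x
  locInt : LocallyIntegrable G volume
  meanZero : (∫ x in cube ℓ, G x) = 0
  weakLap : ∀ φ : E2 → ℝ, ContDiff ℝ (⊤ : ℕ∞) φ → HasCompactSupport φ →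
    (∫ x, G x * lap φ x) =
      -(2 * Real.pi) * ((∑' k : ℤ × ℤ, φ (ℓ • latVec k)) - (ℓ ^ 2)⁻¹ * ∫ x, φ x)


/-- A primitive of a smooth function on the line is smooth. -/
theorem contDiff_primitive {f : ℝ → ℝ} (hf : ContDiff ℝ (⊤ : ℕ∞) f) (a : ℝ) :
    ContDiff ℝ (⊤ : ℕ∞) (fun s => ∫ t in a..s, f t) := by
  have hd : ∀ s, HasDerivAt (fun s => ∫ t in a..s, f t) (f s) s := fun s =>
    intervalIntegral.integral_hasDerivAt_right (hf.continuous.intervalIntegrable _ _)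
      hf.continuous.stronglyMeasurable.stronglyMeasurableAtFilter hf.continuous.continuousAt
  rw [contDiff_infty_iff_deriv]
  exact ⟨fun s => (hd s).differentiableAt, by rwa [funext fun s => (hd s).deriv]⟩

theorem deriv_primitive {f : ℝ → ℝ} (hf : Continuous f) (a : ℝ) :
    deriv (fun s => ∫ t in a..s, f t) = f :=
  funext fun _ => (intervalIntegral.integral_hasDerivAt_right (hf.intervalIntegrable _ _)
      hf.stronglyMeasurable.stronglyMeasurableAtFilter hf.continuousAt).deriv

theorem exists_contDiff_integral_abs_sub_le {f : ℝ → ℝ} (hf : Integrable f) {ε : ℝ} (hε : 0 < ε) :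
    ∃ g : ℝ → ℝ, ContDiff ℝ (⊤ : ℕ∞) g ∧ Integrable g ∧ ∫ s, |f s - g s| ≤ ε := by
  obtain ⟨g, hg, hg', hfg⟩ := (memLp_one_iff_integrable.2 hf).exist_eLpNorm_sub_le
    ENNReal.one_ne_top le_rfl hε
  have hgi : Integrable g := hg'.continuous.integrable_of_hasCompactSupport hg
  refine ⟨g, hg', hgi, ?_⟩
  rw [eLpNorm_one_eq_lintegral_enorm] at hfg
  have := integral_norm_eq_lintegral_enorm (hf.sub hgi).aestronglyMeasurable
  simp only [Pi.sub_apply, Real.norm_eq_abs] at this hfg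
  rw [this]
  exact ENNReal.toReal_le_of_le_ofReal hε.le hfg

/-- Smooth truncation inside an open interval approximates the identity in `L¹`. -/
theorem exists_contDiff_cutoff {f : ℝ → ℝ} (hf : Integrable f) {a b : ℝ} (hab : a < b)
    (hsupp : ∀ s, s ∉ Set.Ioo a b → f s = 0) {ε : ℝ} (hε : 0 < ε) :
    ∃ χ : ℝ → ℝ, ContDiff ℝ (⊤ : ℕ∞) χ ∧ (∀ s, |χ s| ≤ 1) ∧
      (∃ δ, 0 < δ ∧ δ ≤ (b - a) / 8 ∧ ∀ s, s ∉ Set.Icc (a + δ) (b - δ) → χ s = 0) ∧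
      ∫ s, |f s - χ s * f s| ≤ ε := by
  have hab' : 0 < b - a := sub_pos.2 hab
  let δ : ℕ → ℝ := fun n => (b - a) / 8 * (1 / ((n : ℝ) + 1))
  have hδ : ∀ n, 0 < δ n := fun n => by positivity
  have hδ' : ∀ n, δ n ≤ (b - a) / 8 := fun n => by
    refine mul_le_of_le_one_right (by positivity) ?_
    rw [div_le_one (by positivity)]
    linarith [Nat.cast_nonneg (α := ℝ) n]
  have hδ0 : Tendsto δ atTop (𝓝 0) := by
    simpa only [mul_zero] using
      (tendsto_one_div_add_atTop_nhds_zero_nat (𝕜 := ℝ)).const_mul ((b - a) / 8)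
  let χ : ∀ n, ContDiffBump ((a + b) / 2 : ℝ) := fun n =>
    ⟨(b - a) / 2 - 2 * δ n, (b - a) / 2 - δ n, by linarith [hδ' n], by linarith [hδ n]⟩
  have hlim : Tendsto (fun n => ∫ s, |f s - χ n s * f s|) atTop (𝓝 (∫ _ : ℝ, (0 : ℝ))) := by
    refine tendsto_integral_of_dominated_convergence (fun s => |f s|) (fun n => ?_) hf.abs
      (fun n => ae_of_all _ fun s => ?_) (ae_of_all _ fun s => ?_)
    · exact (hf.aestronglyMeasurable.sub
        ((χ n).continuous.aestronglyMeasurable.mul hf.aestronglyMeasurable)).norm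
    · rw [Real.norm_eq_abs, abs_abs, ← one_sub_mul, abs_mul]
      refine mul_le_of_le_one_left (abs_nonneg _) ?_
      rw [abs_le]
      constructor <;> linarith [(χ n).nonneg (x := s), (χ n).le_one (x := s)]
    · by_cases hs : s ∈ Set.Ioo a b
      · refine tendsto_const_nhds.congr' ?_
        have h1 : ∀ᶠ n in atTop, δ n < min (s - a) (b - s) / 2 :=
          hδ0.eventually (gt_mem_nhds (by
            have := lt_min (sub_pos.2 hs.1) (sub_pos.2 hs.2); positivity))
        filter_upwards [h1] with n hn
        have : χ n s = 1 := by
          refine (χ n).one_of_mem_closedBall ?_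
          rw [mem_closedBall, Real.dist_eq, abs_le]
          have h2 := min_le_left (s - a) (b - s)
          have h3 := min_le_right (s - a) (b - s)
          constructor <;> simp only [χ] <;> linarith
        simp [this]
      · simp [hsupp s hs]
  rw [integral_zero] at hlim
  obtain ⟨n, hn⟩ := (hlim.eventually (gt_mem_nhds hε)).exists
  refine ⟨χ n, (χ n).contDiff, fun s => ?_, ⟨δ n, hδ n, hδ' n, fun s hs => ?_⟩, hn.le⟩
  · rw [abs_of_nonneg (χ n).nonneg]; exact (χ n).le_one
  · refine (χ n).zero_of_le_dist ?_
    by_contra! h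
    rw [Real.dist_eq, abs_lt] at h
    simp only [χ] at h
    exact hs ⟨by linarith, by linarith⟩

/-- Derivatives of test functions supported in an interval are `L¹`-dense among the integrable
functions on that interval with vanishing integral. -/
theorem exists_contDiff_integral_abs_sub_deriv_le {f : ℝ → ℝ} (hf : Integrable f) {a b : ℝ}
    (hab : a < b) (hsupp : ∀ s, s ∉ Set.Ioo a b → f s = 0) (h0 : ∫ s, f s = 0)
    {ε : ℝ} (hε : 0 < ε) :
    ∃ K : ℝ → ℝ, ContDiff ℝ (⊤ : ℕ∞) K ∧
      (∃ a' b', a < a' ∧ b' < b ∧ ∀ s, s ∉ Set.Icc a' b' → K s = 0) ∧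
      Integrable (deriv K) ∧ ∫ s, |f s - deriv K s| ≤ ε := by
  obtain ⟨χ, hχ, hχ1, ⟨δ, hδ, hδ', hχ0⟩, hfχ⟩ :=
    exists_contDiff_cutoff hf hab hsupp (show 0 < ε / 4 by positivity)
  obtain ⟨g, hg, hgi, hfg⟩ :=
    exists_contDiff_integral_abs_sub_le hf (show 0 < ε / 4 by positivity)
  have hχm (u : ℝ → ℝ) (hu : Integrable u) : Integrable fun s => χ s * u s :=
    hu.bdd_mul hχ.continuous.aestronglyMeasurable (c := 1) (ae_of_all _ hχ1)
  have hi1 := (hf.sub (hχm f hf)).abs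
  have hi2 := (hf.sub hgi).abs
  have hi3 := (hf.sub (hχm g hgi)).abs
  have hle : ∫ s, |f s - χ s * g s| ≤ ε / 2 := by
    calc ∫ s, |f s - χ s * g s| ≤ ∫ s, (|f s - χ s * f s| + |f s - g s|) := by
          refine integral_mono hi3 (hi1.add hi2) fun s => ?_
          have h1 : f s - χ s * g s = (f s - χ s * f s) + χ s * (f s - g s) := by ring
          simp only
          rw [h1]
          refine (abs_add_le _ _).trans ?_
          rw [abs_mul (χ s)]
          gcongr
          exact mul_le_of_le_one_left (abs_nonneg _) (hχ1 s)
      _ = _ := integral_add hi1 hi2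
      _ ≤ ε / 2 := by linarith
  have hm : |∫ s, χ s * g s| ≤ ε / 2 := by
    refine le_trans ?_ hle
    have h1 : ∫ s, χ s * g s = - ∫ s, (f s - χ s * g s) := by
      rw [integral_sub hf (hχm g hgi), h0]; ring
    rw [h1, abs_neg]
    exact abs_integral_le_integral_abs
  have hab' : 0 < b - a := sub_pos.2 hab
  let β : ContDiffBump ((a + b) / 2 : ℝ) :=
    ⟨(b - a) / 8, (b - a) / 4, by positivity, by linarith⟩
  let B : ℝ → ℝ := β.normed volume
  have hB : ContDiff ℝ (⊤ : ℕ∞) B := β.contDiff_normed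
  have hBi : Integrable B := β.integrable_normed
  have hB1 : ∫ s, B s = 1 := β.integral_normed
  have hB0 : ∀ s, s ∉ Set.Icc (a + δ) (b - δ) → B s = 0 := fun s hs => by
    by_contra h
    have : s ∈ Function.support (β.normed volume) := h
    rw [β.support_normed_eq, mem_ball, Real.dist_eq, abs_lt] at this
    simp only [β] at this
    exact hs ⟨by linarith, by linarith⟩
  set m := ∫ s, χ s * g s
  let F : ℝ → ℝ := fun s => χ s * g s - m * B s
  have hF : ContDiff ℝ (⊤ : ℕ∞) F := (hχ.mul hg).sub (contDiff_const.mul hB)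
  have hFi : Integrable F := (hχm g hgi).sub (hBi.const_mul m)
  have hF0 : ∀ s, s ∉ Set.Icc (a + δ) (b - δ) → F s = 0 := fun s hs => by
    simp [F, hχ0 s hs, hB0 s hs]
  have hFint : ∫ s, F s = 0 := by
    simp only [F]
    rw [integral_sub (hχm g hgi) (hBi.const_mul m), integral_const_mul, hB1]
    simp [m]
  refine ⟨fun s => ∫ t in a..s, F t, contDiff_primitive hF a,
    ⟨a + δ, b - δ, by linarith, by linarith, fun s hs => ?_⟩, ?_, ?_⟩
  · rcases lt_or_ge s (a + δ) with h | h
    · refine intervalIntegral.integral_zero_ae (ae_of_all _ fun t ht => hF0 t fun h' => ?_)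
      rw [Set.mem_uIoc] at ht
      rcases ht with ht | ht <;> linarith [h'.1]
    · have h' : b - δ < s := by
        by_contra! h''
        exact hs ⟨h, h''⟩
      simp only
      rw [intervalIntegral.integral_of_le (by linarith), ← hFint]
      refine setIntegral_eq_integral_of_forall_compl_eq_zero fun t ht => hF0 t fun h'' => ht ?_
      exact ⟨by linarith [h''.1], by linarith [h''.2]⟩
  · rwa [deriv_primitive hF.continuous]
  · rw [deriv_primitive hF.continuous]
    calc ∫ s, |f s - F s| ≤ ∫ s, (|f s - χ s * g s| + |m| * B s) := by
          refine integral_mono (hf.sub hFi).abs (hi3.add (hBi.const_mul _)) fun s => ?_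
          have h1 : f s - F s = (f s - χ s * g s) + m * B s := by simp only [F]; ring
          simp only
          rw [h1]
          refine (abs_add_le _ _).trans ?_
          rw [abs_mul, abs_of_nonneg (β.nonneg_normed s : 0 ≤ B s)]
      _ = (∫ s, |f s - χ s * g s|) + |m| * ∫ s, B s := by
          rw [← integral_const_mul]; exact integral_add hi3 (hBi.const_mul _)
      _ ≤ ε := by rw [hB1]; linarith

theorem iteratedDeriv_two_comp_quadratic {W : ℝ → ℝ} (hW : ContDiff ℝ (⊤ : ℕ∞) W) (q p : ℝ) :
    iteratedDeriv 2 (fun t : ℝ => W (q + 2 * p * t + t ^ 2)) 0 =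
      deriv (deriv W) q * (4 * p ^ 2) + 2 * deriv W q := by
  have hW' : ContDiff ℝ (⊤ : ℕ∞) (deriv W) := (contDiff_infty_iff_deriv.1 hW).2
  have hq (t : ℝ) : HasDerivAt (fun t : ℝ => q + 2 * p * t + t ^ 2) (2 * p + 2 * t) t := by
    have h1 := (((hasDerivAt_id t).const_mul (2 * p)).const_add q).add ((hasDerivAt_id t).pow 2)
    convert! h1 using 1
    simp
  have h1 : deriv (fun t : ℝ => W (q + 2 * p * t + t ^ 2)) =
      fun t => deriv W (q + 2 * p * t + t ^ 2) * (2 * p + 2 * t) := funext fun t =>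
    (((hW.differentiable (by simp)) _).hasDerivAt.comp t (hq t)).deriv
  have h2 : HasDerivAt (fun t : ℝ => 2 * p + 2 * t) 2 0 := by
    simpa using ((hasDerivAt_id (0 : ℝ)).const_mul 2).const_add (2 * p)
  have h3 := ((((hW'.differentiable (by simp)) _).hasDerivAt.comp 0 (hq 0))).mul h2
  rw [iteratedDeriv_succ, iteratedDeriv_one, h1]
  refine h3.deriv.trans ?_
  simp
  ring

theorem lap_comp_norm_sq {W : ℝ → ℝ} (hW : ContDiff ℝ (⊤ : ℕ∞) W) (x z : E2) :
    lap (fun z => W (‖z - x‖ ^ 2)) z =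
      4 * (deriv W (‖z - x‖ ^ 2) + ‖z - x‖ ^ 2 * deriv (deriv W) (‖z - x‖ ^ 2)) := by
  have h (i : Fin 2) (t : ℝ) : ‖z + t • EuclideanSpace.single i (1 : ℝ) - x‖ ^ 2 =
      ‖z - x‖ ^ 2 + 2 * (z - x) i * t + t ^ 2 := by
    rw [show z + t • EuclideanSpace.single i (1 : ℝ) - x =
      (z - x) + t • EuclideanSpace.single i (1 : ℝ) by abel, norm_add_sq_real, inner_smul_right,
      EuclideanSpace.inner_single_right, norm_smul]
    simp
    ring
  simp only [lap, h, iteratedDeriv_two_comp_quadratic hW]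
  rw [Fin.sum_univ_two, EuclideanSpace.real_norm_sq_eq (z - x), Fin.sum_univ_two]
  ring

/-- A function vanishing near the origin may be divided by the variable smoothly. -/
theorem contDiff_div_self {K : ℝ → ℝ} (hK : ContDiff ℝ (⊤ : ℕ∞) K) {a : ℝ} (ha : 0 < a)
    (h0 : ∀ s, s < a → K s = 0) : ContDiff ℝ (⊤ : ℕ∞) (fun s => K s / s) := by
  rw [contDiff_iff_contDiffAt]
  intro s
  rcases lt_or_ge s a with h | h
  · refine (contDiffAt_const (c := (0 : ℝ))).congr_of_eventuallyEq ?_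
    filter_upwards [gt_mem_nhds h] with t ht
    simp [h0 t ht]
  · exact hK.contDiffAt.div contDiffAt_id (by simp; linarith)

/-- A radial density of the form `K'(|x|²)` with `K` compactly supported away from the origin is
the Laplacian of a compactly supported smooth radial potential. -/
theorem exists_lap_eq {K : ℝ → ℝ} (hK : ContDiff ℝ (⊤ : ℕ∞) K) {a b : ℝ} (ha : 0 < a)
    (h0 : ∀ s, s ∉ Set.Icc a b → K s = 0) :
    ∃ W : ℝ → ℝ, ContDiff ℝ (⊤ : ℕ∞) W ∧ (∀ s, b ≤ s → W s = 0) ∧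
      ∀ x z : E2, lap (fun z => W (‖z - x‖ ^ 2)) z = 4 * deriv K (‖z - x‖ ^ 2) := by
  have hd := contDiff_div_self hK ha fun s hs => h0 s fun h => by linarith [h.1]
  have hW := contDiff_primitive hd b
  refine ⟨fun s => ∫ t in b..s, K t / t, hW, fun s hs => ?_, fun x z => ?_⟩
  · refine intervalIntegral.integral_zero_ae (ae_of_all _ fun t ht => ?_)
    rw [Set.uIoc_of_le hs] at ht
    rw [h0 t fun h => by linarith [h.2, ht.1], zero_div]
  · rw [lap_comp_norm_sq hW, deriv_primitive hd.continuous]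
    set s := ‖z - x‖ ^ 2
    congr 1
    have hKs : K = fun s => s * (K s / s) := by
      funext s
      rcases eq_or_ne s 0 with rfl | hs
      · rw [h0 0 fun h => by linarith [h.1]]; simp
      · field_simp
    have h1 := (hasDerivAt_id s).mul ((hd.differentiable (by simp)) s).hasDerivAt
    rw [(h1.congr_of_eventuallyEq (.of_forall (congrFun hKs))).deriv]
    simp

theorem eq_zero_of_mem_cube {L : ℝ} (hL : 0 < L) {x : E2} {k : ℤ × ℤ} (hx : x ∈ cube L)
    (hk : x - L • latVec k ∈ cube L) : k = 0 := by
  have h (i : Fin 2) (n : ℤ) (hn : latVec k i = n) : n = 0 := by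
    have h1 := hx i
    have h2 := hk i
    rw [PiLp.sub_apply, PiLp.smul_apply, hn, smul_eq_mul] at h2
    have h3 : (n : ℝ) < 1 := by
      by_contra! h
      nlinarith [h1.2, h2.1]
    have h4 : (-1 : ℝ) < n := by
      by_contra! h
      nlinarith [h1.1, h2.2]
    have h5 : n < 1 := by exact_mod_cast h3
    have h6 : -1 < n := by exact_mod_cast h4
    omega
  exact Prod.ext (h 0 _ (by simp [latVec])) (h 1 _ (by simp [latVec]))

theorem sq_le_norm_sq_latVec_sub {L R : ℝ} (hL : 0 < L) (hR : 0 < R)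
    (hsub : closedBall (0 : E2) R ⊆ cube L) {x : E2} (hx : x ∈ cube L \ closedBall 0 R)
    (k : ℤ × ℤ) : R ^ 2 ≤ ‖L • latVec k - x‖ ^ 2 := by
  by_contra! h
  have h1 : x - L • latVec k ∈ closedBall (0 : E2) R := by
    rw [mem_closedBall_zero_iff, norm_sub_rev]
    exact (lt_of_pow_lt_pow_left₀ 2 hR.le h).le
  obtain rfl := eq_zero_of_mem_cube hL hx.1 (hsub h1)
  refine hx.2 ?_
  have : latVec 0 = 0 := by
    ext i
    fin_cases i <;> simp [latVec]
  simpa [this] using h1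

/-- Newton's theorem for smooth neutral radial densities supported in an annulus. -/
theorem integral_deriv_norm_sq_mul_eq {L R : ℝ} (hL : 0 < L) (hR : 0 < R)
    (hsub : closedBall (0 : E2) R ⊆ cube L) {G : E2 → ℝ} (hG : IsPeriodicCoulomb L G)
    {K : ℝ → ℝ} (hK : ContDiff ℝ (⊤ : ℕ∞) K) {a b : ℝ} (ha : 0 < a) (hb : b ≤ R ^ 2)
    (h0 : ∀ s, s ∉ Set.Icc a b → K s = 0) :
    ∃ c : ℝ, ∀ x ∈ cube L \ closedBall (0 : E2) R,
      ∫ y, deriv K (‖y‖ ^ 2) * G (x - y) = c := by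
  obtain ⟨W, hW, hW0, hlap⟩ := exists_lap_eq hK ha h0
  refine ⟨2 * π * ((L ^ 2)⁻¹ * ∫ z : E2, W (‖z‖ ^ 2)) / 4, fun x hx => ?_⟩
  have hφ : ContDiff ℝ (⊤ : ℕ∞) fun z : E2 => W (‖z - x‖ ^ 2) :=
    hW.comp ((contDiff_id.sub contDiff_const).norm_sq ℝ)
  have hφc : HasCompactSupport fun z : E2 => W (‖z - x‖ ^ 2) := by
    refine HasCompactSupport.intro (isCompact_closedBall x R) fun z hz => hW0 _ (hb.trans ?_)
    rw [mem_closedBall, dist_eq_norm, not_le] at hz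
    exact pow_le_pow_left₀ hR.le hz.le 2
  have key := hG.weakLap _ hφ hφc
  simp only [hlap] at key
  rw [tsum_congr fun k => hW0 _ (hb.trans (sq_le_norm_sq_latVec_sub hL hR hsub hx k)), tsum_zero,
    integral_sub_right_eq_self (fun z : E2 => W (‖z‖ ^ 2)) x] at key
  have h1 : ∫ y, deriv K (‖y‖ ^ 2) * G (x - y) = ∫ z, deriv K (‖z - x‖ ^ 2) * G z := by
    rw [← integral_sub_left_eq_self (fun z => deriv K (‖z - x‖ ^ 2) * G z) volume x]
    simp
  have h2 : ∫ z, G z * (4 * deriv K (‖z - x‖ ^ 2)) = 4 * ∫ z, deriv K (‖z - x‖ ^ 2) * G z := by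
    rw [← integral_const_mul]
    exact integral_congr_ae (ae_of_all _ fun z => by simp only; ring)
  rw [h1]
  rw [h2] at key
  linarith

theorem integral_comp_norm_sq (f : ℝ → ℝ) :
    ∫ x : E2, f (‖x‖ ^ 2) = volume.real (ball (0 : E2) 1) * ∫ s in Set.Ioi (0 : ℝ), f s := by
  rw [integral_fun_norm_addHaar volume (fun r => f (r ^ 2)),
    ← integral_comp_rpow_Ioi f (two_ne_zero (α := ℝ))]
  rw [finrank_euclideanSpace_fin, nsmul_eq_mul, smul_eq_mul, mul_left_comm, ← integral_const_mul]
  congr 1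
  refine setIntegral_congr_fun measurableSet_Ioi fun r _ => ?_
  norm_num [abs_of_nonneg]
  ring

theorem integrable_comp_norm_sq_iff {f : ℝ → ℝ} :
    Integrable (fun x : E2 => f (‖x‖ ^ 2)) ↔ IntegrableOn f (Set.Ioi 0) := by
  rw [integrable_fun_norm_addHaar volume (f := fun r => f (r ^ 2)),
    ← integrableOn_Ioi_comp_rpow_iff' f (two_ne_zero (α := ℝ))]
  norm_num

/-- Bounded neutral radial densities supported in a ball are `L¹`-limits of smooth neutral radial
densities supported in annuli inside that ball. -/
theorem exists_radial_approx {R : ℝ} (hR : 0 < R) {ρ : E2 → ℝ} (hmeas : Measurable ρ)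
    (hbdd : ∃ C : ℝ, ∀ x, |ρ x| ≤ C) (hrad : ∀ x y : E2, ‖x‖ = ‖y‖ → ρ x = ρ y)
    (hsupp : ∀ x, x ∉ closedBall (0 : E2) R → ρ x = 0) (hneutral : (∫ x, ρ x) = 0)
    {ε : ℝ} (hε : 0 < ε) :
    ∃ K : ℝ → ℝ, ContDiff ℝ (⊤ : ℕ∞) K ∧
      (∃ a b, 0 < a ∧ b < R ^ 2 ∧ ∀ s, s ∉ Set.Icc a b → K s = 0) ∧
      Integrable (fun x : E2 => deriv K (‖x‖ ^ 2)) ∧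
      ∫ x : E2, |ρ x - deriv K (‖x‖ ^ 2)| ≤ ε := by
  obtain ⟨C, hC⟩ := hbdd
  let h : ℝ → ℝ := fun s => ρ (EuclideanSpace.single 0 √s)
  let f : ℝ → ℝ := (Set.Ioo 0 (R ^ 2)).indicator h
  have hsingle : Continuous fun r : ℝ => (EuclideanSpace.single 0 r : E2) :=
    continuous_iff_continuous_dist.2 (by simpa using continuous_dist)
  have hhm : Measurable h := hmeas.comp (hsingle.measurable.comp Real.continuous_sqrt.measurable)
  have hfi : Integrable f := by
    rw [integrable_indicator_iff measurableSet_Ioo]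
    exact Measure.integrableOn_of_bounded (by simp) hhm.aestronglyMeasurable
      (ae_of_all _ fun s => hC _)
  have hf0 : ∀ s, s ∉ Set.Ioo 0 (R ^ 2) → f s = 0 := fun s hs => Set.indicator_of_notMem hs _
  have hρf : ∀ᵐ x : E2, ρ x = f (‖x‖ ^ 2) := by
    have h1 : ∀ᵐ x : E2, x ∉ sphere (0 : E2) R :=
      measure_eq_zero_iff_ae_notMem.1 (Measure.addHaar_sphere volume _ _)
    have h2 : ∀ᵐ x : E2, x ∉ ({0} : Set E2) :=
      measure_eq_zero_iff_ae_notMem.1 (measure_singleton _)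
    filter_upwards [h1, h2] with x hx1 hx2
    have hpos : 0 < ‖x‖ := norm_pos_iff.2 hx2
    by_cases hx : ‖x‖ < R
    · have : ‖x‖ ^ 2 ∈ Set.Ioo 0 (R ^ 2) := ⟨by positivity, by gcongr⟩
      simp only [f, Set.indicator_of_mem this, h]
      exact hrad _ _ (by simp)
    · have hx' : R < ‖x‖ := lt_of_le_of_ne (not_lt.1 hx) fun h => hx1 (by simp [h])
      rw [hf0 _ fun h => hx (lt_of_pow_lt_pow_left₀ 2 hR.le h.2), hsupp]
      simpa using hx'
  have hv : 0 < volume.real (ball (0 : E2) 1) :=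
    ENNReal.toReal_pos (measure_ball_pos _ _ one_pos).ne' measure_ball_lt_top.ne
  have hfint : ∫ s, f s = 0 := by
    rw [integral_congr_ae hρf, integral_comp_norm_sq] at hneutral
    rw [← setIntegral_eq_integral_of_forall_compl_eq_zero (s := Set.Ioi 0)
      fun s hs => hf0 s fun h => hs h.1]
    exact (mul_eq_zero.1 hneutral).resolve_left hv.ne'
  obtain ⟨K, hK, ⟨a, b, ha, hb, hK0⟩, hKi, hfK⟩ :=
    exists_contDiff_integral_abs_sub_deriv_le hfi (by positivity : (0 : ℝ) < R ^ 2) hf0 hfint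
      (div_pos hε hv)
  refine ⟨K, hK, ⟨a, b, ha, hb, hK0⟩, integrable_comp_norm_sq_iff.2 hKi.integrableOn, ?_⟩
  calc ∫ x : E2, |ρ x - deriv K (‖x‖ ^ 2)|
      = ∫ x : E2, |f (‖x‖ ^ 2) - deriv K (‖x‖ ^ 2)| :=
        integral_congr_ae (by filter_upwards [hρf] with x hx; rw [hx])
    _ = volume.real (ball (0 : E2) 1) * ∫ s in Set.Ioi (0 : ℝ), |f s - deriv K s| :=
        integral_comp_norm_sq fun s => |f s - deriv K s|
    _ ≤ volume.real (ball (0 : E2) 1) * ∫ s, |f s - deriv K s| := by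
        refine mul_le_mul_of_nonneg_left ?_ hv.le
        exact setIntegral_le_integral (hfi.sub hKi).abs (ae_of_all _ fun s => abs_nonneg _)
    _ ≤ ε := by
        rw [← le_div_iff₀' hv]; exact hfK

/-- Truncating a locally integrable kernel does not affect convolutions of compactly supported
densities on bounded sets. -/
theorem indicator_closedBall_sub {A R : ℝ} (G : E2 → ℝ) {x y : E2} (hx : x ∈ closedBall 0 A)
    (hy : y ∈ closedBall 0 R) : (closedBall (0 : E2) (A + R)).indicator G (x - y) = G (x - y) := by
  refine Set.indicator_of_mem ?_ _
  rw [mem_closedBall_zero_iff] at *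
  exact (norm_sub_le x y).trans (add_le_add hx hy)

theorem integral_abs_convolution_le {f g : E2 → ℝ} (hf : Integrable f) (hg : Integrable g) :
    ∫ x, |∫ y, f y * g (x - y)| ≤ (∫ y, |g y|) * ∫ y, |f y| := by
  have h1 := integral_convolution (ContinuousLinearMap.mul ℝ ℝ) hf.abs hg.abs
  have h2 := hf.integrable_convolution (ContinuousLinearMap.mul ℝ ℝ) hg
  have h3 := hf.abs.integrable_convolution (ContinuousLinearMap.mul ℝ ℝ) hg.abs
  simp only [convolution_def, ContinuousLinearMap.mul_apply'] at h1 h2 h3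
  rw [mul_comm, ← h1]
  refine integral_mono h2.abs h3 fun x => ?_
  simpa only [abs_mul] using abs_integral_le_integral_abs (f := fun y => f y * g (x - y))

/-- A Young-type inequality on bounded sets for a locally integrable kernel. -/
theorem exists_setIntegral_abs_convolution_le {G : E2 → ℝ} (hG : LocallyIntegrable G) (A R : ℝ)
    {S : Set E2} (hS : MeasurableSet S) (hSA : S ⊆ closedBall 0 A) :
    ∃ M : ℝ, 0 ≤ M ∧ ∀ f : E2 → ℝ, Integrable f → (∀ y, y ∉ closedBall (0 : E2) R → f y = 0) →
      (∀ᵐ x ∂volume.restrict S, Integrable fun y => f y * G (x - y)) ∧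
      IntegrableOn (fun x => ∫ y, f y * G (x - y)) S ∧
      ∫ x in S, |∫ y, f y * G (x - y)| ≤ M * ∫ y, |f y| := by
  let g := (closedBall (0 : E2) (A + R)).indicator G
  have hg : Integrable g := (integrable_indicator_iff measurableSet_closedBall).2
    (hG.integrableOn_isCompact (isCompact_closedBall _ _))
  refine ⟨∫ y, |g y|, integral_nonneg fun _ => abs_nonneg _, fun f hf hf0 => ?_⟩
  have heq' : ∀ x ∈ S, (fun y => f y * g (x - y)) = fun y => f y * G (x - y) := fun x hx => by
    funext y
    by_cases hy : y ∈ closedBall (0 : E2) R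
    · simp only [g, indicator_closedBall_sub G (hSA hx) hy]
    · simp [hf0 y hy]
  have heq : ∀ x ∈ S, ∫ y, f y * g (x - y) = ∫ y, f y * G (x - y) := fun x hx => by
    rw [heq' x hx]
  have hi : Integrable fun x => ∫ y, f y * g (x - y) :=
    hf.integrable_convolution (ContinuousLinearMap.mul ℝ ℝ) hg
  refine ⟨?_, hi.integrableOn.congr_fun heq hS, ?_⟩
  · have hae : ∀ᵐ x, Integrable fun y => f y * g (x - y) :=
      (hf.convolution_integrand (ContinuousLinearMap.mul ℝ ℝ) hg).prod_right_ae
    filter_upwards [ae_restrict_of_ae hae, ae_restrict_mem hS] with x hx hxS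
    rwa [heq' x hxS] at hx
  rw [← setIntegral_congr_fun hS fun x hx => congrArg abs (heq x hx)]
  exact (setIntegral_le_integral hi.abs (ae_of_all _ fun _ => abs_nonneg _)).trans
    (integral_abs_convolution_le hf hg)

/-- An `L¹`-limit of constants is almost everywhere constant. -/
theorem exists_ae_eq_const_of_forall_exists_integral_le {α : Type*} [MeasurableSpace α]
    {μ : Measure α} [IsFiniteMeasure μ] {u : α → ℝ} (hu : Integrable u μ)
    (h : ∀ ε > 0, ∃ c : ℝ, ∫ x, |u x - c| ∂μ ≤ ε) : ∃ c : ℝ, ∀ᵐ x ∂μ, u x = c := by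
  rcases eq_or_ne μ 0 with rfl | hμ
  · exact ⟨0, by simp⟩
  have hm : 0 < μ.real Set.univ :=
    ENNReal.toReal_pos (Measure.measure_univ_pos.2 hμ).ne' (measure_ne_top _ _)
  set m := μ.real Set.univ with hmdef
  set c₀ := (∫ x, u x ∂μ) / m
  have hle : ∀ ε > 0, ∫ x, |u x - c₀| ∂μ ≤ ε := fun ε hε => by
    obtain ⟨c, hc⟩ := h (ε / 2) (by positivity)
    have hi : Integrable (fun x => |u x - c|) μ := (hu.sub (integrable_const c)).abs
    have h1 : |c - c₀| * m ≤ ε / 2 := by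
      refine le_trans ?_ hc
      have h2 : (c₀ - c) * m = ∫ x, (u x - c) ∂μ := by
        rw [integral_sub hu (integrable_const c), integral_const, smul_eq_mul, ← hmdef]
        simp only [c₀]
        field_simp
      rw [abs_sub_comm, ← abs_of_pos hm, ← abs_mul, h2]
      exact abs_integral_le_integral_abs
    calc ∫ x, |u x - c₀| ∂μ ≤ ∫ x, (|u x - c| + |c - c₀|) ∂μ :=
          integral_mono (hu.sub (integrable_const c₀)).abs (hi.add (integrable_const _))
            fun x => abs_sub_le _ _ _
      _ = (∫ x, |u x - c| ∂μ) + |c - c₀| * m := by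
          rw [integral_add hi (integrable_const _), integral_const, smul_eq_mul, mul_comm]
      _ ≤ ε := by linarith
  refine ⟨c₀, ?_⟩
  have h0 : ∫ x, |u x - c₀| ∂μ = 0 :=
    le_antisymm (le_of_forall_pos_le_add fun ε hε => by simpa using hle ε hε)
      (integral_nonneg fun _ => abs_nonneg _)
  have hi : Integrable (fun x => |u x - c₀|) μ := (hu.sub (integrable_const c₀)).abs
  filter_upwards [(integral_eq_zero_iff_of_nonneg (fun _ => abs_nonneg _) hi).1 h0] with x hx
  exact sub_eq_zero.1 (abs_eq_zero.1 hx)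

theorem cube_subset_closedBall (L : ℝ) : cube L ⊆ closedBall 0 L := fun x hx => by
  have h0 := hx 0
  have h1 := hx 1
  have hL : 0 ≤ L := by linarith [h0.1, h0.2]
  rw [mem_closedBall_zero_iff, ← sq_le_sq₀ (norm_nonneg _) hL, EuclideanSpace.real_norm_sq_eq,
    Fin.sum_univ_two]
  nlinarith [h0.1, h0.2, h1.1, h1.2]

theorem measurableSet_cube (L : ℝ) : MeasurableSet (cube L) := by
  refine IsOpen.measurableSet ?_
  simp only [cube, Set.ofPred_forall]
  exact isOpen_iInter_of_finite fun i =>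
    isOpen_Ioo.preimage (by fun_prop : Continuous fun x : E2 => x i)

theorem neg_mem_cube_sdiff {L R : ℝ} {x : E2} (hx : x ∈ cube L \ closedBall (0 : E2) R) :
    -x ∈ cube L \ closedBall (0 : E2) R := by
  refine ⟨fun i => ?_, by simpa using hx.2⟩
  have := hx.1 i
  exact ⟨by simpa using this.2, by simpa using neg_lt_neg this.1⟩

theorem integrable_of_bounded_of_support {f : E2 → ℝ} (hf : Measurable f)
    (hbdd : ∃ C : ℝ, ∀ x, |f x| ≤ C) {R : ℝ} (hsupp : ∀ x, x ∉ closedBall (0 : E2) R → f x = 0) :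
    Integrable f := by
  obtain ⟨C, hC⟩ := hbdd
  refine (integrableOn_iff_integrable_of_support_subset (s := closedBall (0 : E2) R) ?_).1 ?_
  · exact fun x hx => by_contra fun h => hx (hsupp x h)
  · exact Measure.integrableOn_of_bounded measure_closedBall_lt_top.ne hf.aestronglyMeasurable
      (ae_of_all _ hC)

theorem ae_eq_const_convolution {L R : ℝ} (hL : 0 < L) (hR : 0 < R)
    (hsub : closedBall (0 : E2) R ⊆ cube L) {G : E2 → ℝ} (hG : IsPeriodicCoulomb L G)
    {ρ : E2 → ℝ} (hmeas : Measurable ρ) (hbdd : ∃ C : ℝ, ∀ x, |ρ x| ≤ C)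
    (hrad : ∀ x y : E2, ‖x‖ = ‖y‖ → ρ x = ρ y)
    (hsupp : ∀ x, x ∉ closedBall (0 : E2) R → ρ x = 0) (hneutral : (∫ x, ρ x) = 0) :
    ∃ c : ℝ, ∀ᵐ x : E2, x ∈ cube L \ closedBall (0 : E2) R → ∫ y, ρ y * G (x - y) = c := by
  set S := cube L \ closedBall (0 : E2) R with hSdef
  have hS : MeasurableSet S := (measurableSet_cube L).diff measurableSet_closedBall
  have hSL : S ⊆ closedBall 0 L := Set.sdiff_subset.trans (cube_subset_closedBall L)
  have : IsFiniteMeasure (volume.restrict S) :=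
    ⟨by simpa using (measure_mono hSL).trans_lt measure_closedBall_lt_top⟩
  have hρ := integrable_of_bounded_of_support hmeas hbdd hsupp
  obtain ⟨M, hM, hconv⟩ := exists_setIntegral_abs_convolution_le hG.locInt L R hS hSL
  obtain ⟨hρG, hu, -⟩ := hconv ρ hρ hsupp
  obtain ⟨c, hc⟩ := exists_ae_eq_const_of_forall_exists_integral_le hu fun ε hε => by
    obtain ⟨K, hK, ⟨a, b, ha, hb, hK0⟩, hKi, hρK⟩ := exists_radial_approx hR hmeas hbdd hrad hsupp
      hneutral (show 0 < ε / (M + 1) by positivity)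
    have hK'0 : ∀ y : E2, y ∉ closedBall (0 : E2) R → deriv K (‖y‖ ^ 2) = 0 := fun y hy => by
      have hby : b < ‖y‖ ^ 2 := by
        rw [mem_closedBall_zero_iff, not_le] at hy
        exact hb.trans (by gcongr)
      have h1 : K =ᶠ[𝓝 (‖y‖ ^ 2)] fun _ => 0 := by
        filter_upwards [lt_mem_nhds hby] with s hs
        exact hK0 s fun h => hs.not_ge h.2
      rw [h1.deriv_eq, deriv_const]
    obtain ⟨c, hc⟩ := integral_deriv_norm_sq_mul_eq hL hR hsub hG hK ha hb.le hK0
    obtain ⟨hKG, -, -⟩ := hconv _ hKi hK'0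
    obtain ⟨-, -, hle⟩ := hconv (fun y => ρ y - deriv K (‖y‖ ^ 2)) (hρ.sub hKi)
      fun y hy => by rw [hsupp y hy, hK'0 y hy, sub_zero]
    refine ⟨c, ?_⟩
    calc ∫ x in S, |(∫ y, ρ y * G (x - y)) - c|
        = ∫ x in S, |∫ y, (ρ y - deriv K (‖y‖ ^ 2)) * G (x - y)| := by
          refine integral_congr_ae ?_
          filter_upwards [hρG, hKG, ae_restrict_mem hS] with x h1 h2 hx
          simp only [sub_mul]
          rw [integral_sub h1 h2, hc x hx]
      _ ≤ M * (ε / (M + 1)) := hle.trans (by gcongr)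
      _ ≤ ε := by
          rw [mul_div_assoc', div_le_iff₀ (by positivity)]
          nlinarith
  exact ⟨c, (ae_restrict_iff' hS).1 hc⟩

/-- Newton's theorem for the periodic Coulomb potential: a bounded measurable radial
neutral charge density `ρ` supported in `B_R ⊆ C_L` has periodic potential `ρ ∗ G_L`
a.e. constant on `C_L ∖ B_R`; consequently its interaction with any bounded measurable
neutral `ρ′` supported in `C_L ∖ B_R` vanishes. -/
theorem newton_periodic (L R : ℝ) (hL : 0 < L) (hR : 0 < R)
    (hsub : Metric.closedBall (0 : E2) R ⊆ cube L)
    (G : E2 → ℝ) (hG : IsPeriodicCoulomb L G)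
    (ρ : E2 → ℝ) (hmeas : Measurable ρ) (hbdd : ∃ C : ℝ, ∀ x, |ρ x| ≤ C)
    (hrad : ∀ x y : E2, ‖x‖ = ‖y‖ → ρ x = ρ y)
    (hsupp : ∀ x, x ∉ Metric.closedBall (0 : E2) R → ρ x = 0)
    (hneutral : (∫ x, ρ x) = 0) :
    (∃ c : ℝ, ∀ᵐ x : E2, x ∈ cube L \ Metric.closedBall (0 : E2) R →
        (∫ y, ρ y * G (x - y)) = c) ∧
      ∀ ρ' : E2 → ℝ, Measurable ρ' → (∃ C : ℝ, ∀ x, |ρ' x| ≤ C) →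
        (∀ x, x ∉ cube L \ Metric.closedBall (0 : E2) R → ρ' x = 0) →
        (∫ x, ρ' x) = 0 →
        (∫ x, ∫ y, G (x - y) * ρ x * ρ' y) = 0 := by
  obtain ⟨c, hc⟩ := ae_eq_const_convolution hL hR hsub hG hmeas hbdd hrad hsupp hneutral
  refine ⟨⟨c, hc⟩, fun ρ' hmeas' hbdd' hsupp' hneutral' => ?_⟩
  have hρ := integrable_of_bounded_of_support hmeas hbdd hsupp
  have hρ' := integrable_of_bounded_of_support hmeas' hbdd'
    fun x hx => hsupp' x fun h => hx (cube_subset_closedBall L h.1)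
  let g := (closedBall (0 : E2) (R + L)).indicator G
  have hg : Integrable g := (integrable_indicator_iff measurableSet_closedBall).2
    (hG.locInt.integrableOn_isCompact (isCompact_closedBall _ _))
  have hgG (x y : E2) : G (x - y) * ρ x * ρ' y = ρ x * (ρ' y * g (x - y)) := by
    by_cases hx : x ∈ closedBall (0 : E2) R
    · by_cases hy : y ∈ closedBall (0 : E2) L
      · simp only [g, indicator_closedBall_sub G hx hy]
        ring
      · simp [hsupp' y fun h => hy (cube_subset_closedBall L h.1)]
    · simp [hsupp x hx]
  have hint : Integrable (fun p : E2 × E2 => ρ p.1 * (ρ' p.2 * g (p.1 - p.2)))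
      (volume.prod volume) := by
    obtain ⟨C, hC⟩ := hbdd
    exact (hρ'.convolution_integrand (ContinuousLinearMap.mul ℝ ℝ) hg).bdd_mul
      (hmeas.comp measurable_fst).aestronglyMeasurable (c := C) (ae_of_all _ fun p => hC p.1)
  have hae : ∀ᵐ y : E2, ∫ x, G (x - y) * ρ x * ρ' y = c * ρ' y := by
    have h1 : ∀ᵐ y : E2, -y ∈ cube L \ closedBall (0 : E2) R →
        ∫ z, ρ z * G (-y - z) = c :=
      (Measure.measurePreserving_neg (volume : Measure E2)).quasiMeasurePreserving.ae hc
    filter_upwards [h1] with y hy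
    by_cases hyS : y ∈ cube L \ closedBall (0 : E2) R
    · rw [integral_mul_const, ← hy (neg_mem_cube_sdiff hyS), ← integral_neg_eq_self]
      congr 1
      refine integral_congr_ae (ae_of_all _ fun x => ?_)
      simp only [hrad (-x) x (norm_neg x)]
      rw [mul_comm, show -x - y = -y - x by abel]
    · simp [hsupp' y hyS]
  have hswap := integral_integral_swap (f := fun x y => ρ x * (ρ' y * g (x - y))) hint
  simp only [← hgG] at hswap
  rw [hswap, integral_congr_ae hae, integral_const_mul, hneutral', mul_zero]
end
end

section
/- Let χ₃ be the unique nontrivial Dirichlet character modulo 3, let L(·, χ₃) denote the analytically continued Dirichlet L-function, and let ζ denote the analytically continued Riemann zeta function. Then the function F(s) = 3·(2/√3)^{−s/2}·ζ(s/2)·L(s/2, χ₃) is differentiable at s = 0 and F′(0) = (1/8)·log(48π/Γ(1/6)⁶), where Γ is the Gamma function. (F is the Epstein zeta function of the triangular lattice of covolume 1, and F′(0) is the Jellium energy density of the triangular lattice configuration in dimension 2.) -/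
open scoped Real

noncomputable section

open Complex Filter Topology HurwitzZeta

lemma hasDerivAt_ofReal_add_cpow {x t : ℝ} (h : 0 < x + t) (r : ℂ) :
    HasDerivAt (fun t : ℝ ↦ ((x : ℂ) + t) ^ r) (r * ((x : ℂ) + t) ^ (r - 1)) t := by
  have hmem : (x : ℂ) + t ∈ slitPlane := by
    rw [← ofReal_add]
    exact ofReal_mem_slitPlane.mpr h
  simpa using (((hasDerivAt_id (t : ℂ)).const_add (x : ℂ)).cpow_const (c := r) hmem).comp_ofReal

lemma norm_add_cpow_sub_cpow_le {x t : ℝ} (hx : 0 < x) (ht : 0 ≤ t) {r : ℂ} (hr : r.re ≤ 1) :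
    ‖((x : ℂ) + t) ^ r - (x : ℂ) ^ r‖ ≤ ‖r‖ * x ^ (r.re - 1) * t := by
  have key := norm_image_sub_le_of_norm_deriv_le_segment'
    (f := fun u : ℝ ↦ ((x : ℂ) + u) ^ r) (a := 0) (b := t) (C := ‖r‖ * x ^ (r.re - 1))
    (fun u hu ↦ (hasDerivAt_ofReal_add_cpow (by linarith [hu.1]) r).hasDerivWithinAt)
    (fun u hu ↦ ?_) t ⟨ht, le_rfl⟩
  · simpa using key
  · have hxu : 0 < x + u := by linarith [hu.1]
    rw [norm_mul, ← ofReal_add, norm_cpow_eq_rpow_re_of_pos hxu, sub_re, one_re]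
    gcongr ?_ * ?_
    exact Real.rpow_le_rpow_of_nonpos hx (by linarith [hu.1]) (by linarith)

lemma norm_cpow_taylor_remainder_le {x a : ℝ} (hx : 0 < x) (ha : 0 ≤ a) {s : ℂ}
    (hs : -2 ≤ s.re) :
    ‖((x : ℂ) + a) ^ (-s) - (x : ℂ) ^ (-s) + a * s * (x : ℂ) ^ (-s - 1)‖ ≤
      ‖s‖ * ‖s + 1‖ * a ^ 2 * x ^ (-s.re - 2) := by
  have key := norm_image_sub_le_of_norm_deriv_le_segment'
    (f := fun u : ℝ ↦ ((x : ℂ) + u) ^ (-s) + u * (s * (x : ℂ) ^ (-s - 1)))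
    (f' := fun u : ℝ ↦ -s * ((x : ℂ) + u) ^ (-s - 1) + 1 * (s * (x : ℂ) ^ (-s - 1)))
    (a := 0) (b := a) (C := ‖s‖ * (‖s + 1‖ * x ^ (-s.re - 2) * a))
    (fun u hu ↦ ((hasDerivAt_ofReal_add_cpow (by linarith [hu.1]) (-s)).add
      ((HasDerivAt.ofReal_comp (hasDerivAt_id u)).mul_const _)).hasDerivWithinAt)
    (fun u hu ↦ ?_) a ⟨ha, le_rfl⟩
  · convert key using 1
    · congr 1
      simp
      ring
    · ring
  · have h := norm_add_cpow_sub_cpow_le (r := -s - 1) hx hu.1 (by simp; linarith)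
    rw [show -s * ((x : ℂ) + u) ^ (-s - 1) + 1 * (s * (x : ℂ) ^ (-s - 1)) =
      -s * (((x : ℂ) + u) ^ (-s - 1) - (x : ℂ) ^ (-s - 1)) by ring, norm_mul, norm_neg]
    gcongr
    rw [show -s - 1 = -(s + 1) by ring, norm_neg] at h
    rw [show -s - 1 = -(s + 1) by ring]
    refine h.trans ?_
    rw [show (-(s + 1)).re - 1 = -s.re - 2 by simp; ring]
    have := hu.2.le
    gcongr

/-- The general term of the series expansion of `ζ(s, a) - ζ(s)` obtained by subtracting the
first-order Taylor polynomial in `a`. -/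
def hurwitzRemainder (a : ℝ) (n : ℕ) (s : ℂ) : ℂ :=
  (((n + 1 : ℝ) : ℂ) + a) ^ (-s) - ((n + 1 : ℝ) : ℂ) ^ (-s) +
    a * s * ((n + 1 : ℝ) : ℂ) ^ (-s - 1)

lemma hurwitzRemainder_zero (a : ℝ) (n : ℕ) : hurwitzRemainder a n 0 = 0 := by
  simp [hurwitzRemainder]

lemma hasDerivAt_const_cpow_neg {c : ℂ} (hc : c ≠ 0) (s : ℂ) :
    HasDerivAt (fun s : ℂ ↦ c ^ (-s)) (-(c ^ (-s) * log c)) s := by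
  simpa using (hasDerivAt_neg s).const_cpow (c := c) (Or.inl hc)

lemma hasDerivAt_hurwitzRemainder {a : ℝ} (ha : 0 ≤ a) (n : ℕ) (s : ℂ) :
    HasDerivAt (hurwitzRemainder a n)
      (-((((n + 1 : ℝ) : ℂ) + a) ^ (-s) * log (((n + 1 : ℝ) : ℂ) + a)) +
        ((n + 1 : ℝ) : ℂ) ^ (-s) * log ((n + 1 : ℝ) : ℂ) +
        (a * ((n + 1 : ℝ) : ℂ) ^ (-s - 1) -
          a * s * (((n + 1 : ℝ) : ℂ) ^ (-s - 1) * log ((n + 1 : ℝ) : ℂ)))) s := by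
  have h1 : ((n + 1 : ℝ) : ℂ) ≠ 0 := ofReal_ne_zero.mpr (by positivity)
  have h2 : ((n + 1 : ℝ) : ℂ) + a ≠ 0 := by
    rw [← ofReal_add]
    exact ofReal_ne_zero.mpr (by positivity)
  have h3 : HasDerivAt (fun s : ℂ ↦ ((n + 1 : ℝ) : ℂ) ^ (-s - 1))
      (-(((n + 1 : ℝ) : ℂ) ^ (-s - 1) * log ((n + 1 : ℝ) : ℂ))) s := by
    simpa using ((hasDerivAt_neg s).sub_const 1).const_cpow (c := ((n + 1 : ℝ) : ℂ)) (Or.inl h1)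
  have h4 : HasDerivAt (fun s : ℂ ↦ (a : ℂ) * s) a s := by
    simpa using (hasDerivAt_id s).const_mul (a : ℂ)
  convert! ((hasDerivAt_const_cpow_neg h2 s).sub (hasDerivAt_const_cpow_neg h1 s)).add
    (h4.mul h3) using 1
  ring

lemma deriv_hurwitzRemainder_zero {a : ℝ} (ha : 0 ≤ a) (n : ℕ) :
    deriv (hurwitzRemainder a n) 0 =
      ((Real.log (n + 1) - Real.log (a + (n + 1)) + a * (n + 1 : ℝ)⁻¹ : ℝ) : ℂ) := by
  rw [(hasDerivAt_hurwitzRemainder ha n 0).deriv]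
  have h : (((n + 1 : ℝ) : ℂ) + a) = ((a + (n + 1) : ℝ) : ℂ) := by push_cast; ring
  rw [h, ← ofReal_log (by positivity), ← ofReal_log (by positivity)]
  simp [cpow_neg_one]
  ring

/-- A convex open set containing `0` and meeting the half-plane `1 < re s`, on which the series of
`hurwitzRemainder` is dominated by a convergent series. -/
def hurwitzDomain : Set ℂ := {s | -(1 / 2) < s.re} ∩ Metric.ball 0 3

lemma isOpen_hurwitzDomain : IsOpen hurwitzDomain :=
  (isOpen_lt continuous_const continuous_re).inter Metric.isOpen_ball

lemma isPreconnected_hurwitzDomain : IsPreconnected hurwitzDomain :=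
  ((convex_halfSpace_re_gt _).inter (convex_ball _ _)).isPreconnected

lemma zero_mem_hurwitzDomain : (0 : ℂ) ∈ hurwitzDomain := by
  simp [hurwitzDomain]

lemma two_mem_hurwitzDomain : (2 : ℂ) ∈ hurwitzDomain := by
  norm_num [hurwitzDomain]

lemma norm_hurwitzRemainder_le {a : ℝ} (ha : 0 ≤ a) (n : ℕ) {s : ℂ} (hs : s ∈ hurwitzDomain) :
    ‖hurwitzRemainder a n s‖ ≤ 3 * 4 * a ^ 2 * ((n + 1 : ℕ) : ℝ) ^ (-(3 / 2) : ℝ) := by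
  obtain ⟨hs1, hs2⟩ := hs
  simp only [Set.mem_ofPred_eq, mem_ball_zero_iff] at hs1 hs2
  refine (norm_cpow_taylor_remainder_le (by positivity) ha (by linarith)).trans ?_
  have h4 : ‖s + 1‖ ≤ 4 := (norm_add_le _ _).trans (by norm_num; linarith)
  push_cast
  gcongr
  · simp
  · linarith

lemma summable_hurwitzRemainder_bound (a : ℝ) :
    Summable fun n : ℕ ↦ 3 * 4 * a ^ 2 * ((n + 1 : ℕ) : ℝ) ^ (-(3 / 2) : ℝ) :=
  ((summable_nat_add_iff 1).mpr (Real.summable_nat_rpow.mpr (by norm_num))).mul_left _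

/-- The series expansion of `ζ(s, a) - ζ(s)` in the half-plane of absolute convergence. -/
lemma hurwitzZeta_sub_riemannZeta_eq_of_one_lt_re {a : ℝ} (ha : a ∈ Set.Ioc 0 1) {s : ℂ}
    (hs : 1 < s.re) :
    hurwitzZeta a s - riemannZeta s =
      (a : ℂ) ^ (-s) - a * riemannZeta₁ (s + 1) + ∑' n, hurwitzRemainder a n s := by
  have hs0 : s ≠ 0 := by
    rintro rfl
    norm_num at hs
  have hzeta {z : ℂ} (hz : 1 < z.re) :
      HasSum (fun n : ℕ ↦ ((n + 1 : ℝ) : ℂ) ^ (-z)) (riemannZeta z) := by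
    have h := hasSum_hurwitzZeta_of_one_lt_re (a := 1) (by simp) hz
    rw [AddCircle.coe_period, hurwitzZeta_zero] at h
    simpa [cpow_neg] using h
  have hH := hasSum_hurwitzZeta_of_one_lt_re (Set.Ioc_subset_Icc_self ha) hs
  rw [← hasSum_nat_add_iff' 1] at hH
  have h := (hH.sub (hzeta hs)).add ((hzeta (z := s + 1) (by simp; linarith)).mul_left (a * s))
  have hterm : (fun n : ℕ ↦ 1 / (((n + 1 : ℕ) : ℂ) + a) ^ s - ((n + 1 : ℝ) : ℂ) ^ (-s) +
      a * s * ((n + 1 : ℝ) : ℂ) ^ (-(s + 1))) = fun n ↦ hurwitzRemainder a n s := by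
    ext n
    simp [hurwitzRemainder, cpow_neg, ← sub_eq_neg_add]
  rw [hterm] at h
  rw [h.tsum_eq, riemannZeta_eq_inv_sub_mul (s := s + 1) (by simpa using hs0)]
  simp [cpow_neg]
  field_simp
  ring

lemma hurwitzZeta_sub_riemannZeta_eqOn {a : ℝ} (ha : a ∈ Set.Ioc 0 1) :
    Set.EqOn (fun s ↦ hurwitzZeta a s - riemannZeta s)
      (fun s ↦ (a : ℂ) ^ (-s) - a * riemannZeta₁ (s + 1) + ∑' n, hurwitzRemainder a n s)
      hurwitzDomain := by
  have ha0 : (a : ℂ) ≠ 0 := ofReal_ne_zero.mpr ha.1.ne'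
  refine AnalyticOnNhd.eqOn_of_preconnected_of_eventuallyEq
    (DifferentiableOn.analyticOnNhd ?_ isOpen_hurwitzDomain)
    (DifferentiableOn.analyticOnNhd ?_ isOpen_hurwitzDomain)
    isPreconnected_hurwitzDomain two_mem_hurwitzDomain ?_
  · rw [← hurwitzZeta_zero]
    exact (differentiable_hurwitzZeta_sub_hurwitzZeta _ _).differentiableOn
  · refine DifferentiableOn.add (Differentiable.differentiableOn ?_)
      (differentiableOn_tsum_of_summable_norm (summable_hurwitzRemainder_bound a)
        (fun n s _ ↦
          (hasDerivAt_hurwitzRemainder ha.1.le n s).differentiableAt.differentiableWithinAt)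
        isOpen_hurwitzDomain fun n s hs ↦ norm_hurwitzRemainder_le ha.1.le n hs)
    exact fun s ↦ (hasDerivAt_const_cpow_neg ha0 s).differentiableAt.sub
      (by fun_prop)
  · filter_upwards [(isOpen_lt continuous_const continuous_re).mem_nhds
      (show (1 : ℝ) < (2 : ℂ).re by norm_num)] with s hs
    exact hurwitzZeta_sub_riemannZeta_eq_of_one_lt_re ha hs

lemma tendsto_sum_log_sub_log_add {a : ℝ} (ha : 0 < a) :
    Tendsto (fun N : ℕ ↦ ∑ n ∈ Finset.range N,
        (Real.log (n + 1) - Real.log (a + (n + 1)) + a * (n + 1 : ℝ)⁻¹)) atTop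
      (𝓝 (Real.log (Real.Gamma a) + Real.log a + a * Real.eulerMascheroniConstant)) := by
  refine (((Real.BohrMollerup.tendsto_log_gamma ha).add_const (Real.log a)).add
    (Real.tendsto_harmonic_sub_log.const_mul a)).congr fun N ↦ ?_
  have hfac : Real.log (N.factorial : ℝ) = ∑ n ∈ Finset.range N, Real.log (n + 1 : ℝ) := by
    rw [← Finset.prod_range_add_one_eq_factorial, Nat.cast_prod, Real.log_prod]
    · simp
    · intro i _
      positivity
  rw [Real.BohrMollerup.logGammaSeq, Finset.sum_range_succ', hfac, harmonic,
    Finset.sum_add_distrib, Finset.sum_sub_distrib, ← Finset.mul_sum]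
  push_cast
  rw [add_zero]
  ring

/-- **Lerch's formula**, relative to the Riemann zeta function. -/
theorem hasDerivAt_hurwitzZeta_sub_riemannZeta_zero {a : ℝ} (ha : a ∈ Set.Ioc 0 1) :
    HasDerivAt (fun s ↦ hurwitzZeta a s - riemannZeta s)
      ((Real.log (Real.Gamma a) : ℝ) : ℂ) 0 := by
  have ha0 : (a : ℂ) ≠ 0 := ofReal_ne_zero.mpr ha.1.ne'
  have hdiff (n : ℕ) : DifferentiableOn ℂ (hurwitzRemainder a n) hurwitzDomain := fun s _ ↦
    (hasDerivAt_hurwitzRemainder ha.1.le n s).differentiableAt.differentiableWithinAt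
  have hbound (n : ℕ) (s : ℂ) (hs : s ∈ hurwitzDomain) := norm_hurwitzRemainder_le ha.1.le n hs
  have hnhds := isOpen_hurwitzDomain.mem_nhds zero_mem_hurwitzDomain
  have hsum := hasSum_deriv_of_summable_norm (summable_hurwitzRemainder_bound a) hdiff
    isOpen_hurwitzDomain hbound zero_mem_hurwitzDomain
  have hval := tendsto_nhds_unique hsum.tendsto_sum_nat
    (((continuous_ofReal.tendsto _).comp (tendsto_sum_log_sub_log_add ha.1)).congr fun N ↦ by
      simp only [deriv_hurwitzRemainder_zero ha.1.le, Function.comp_apply, ofReal_sum])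
  have htsum := ((differentiableOn_tsum_of_summable_norm (summable_hurwitzRemainder_bound a) hdiff
    isOpen_hurwitzDomain hbound).differentiableAt hnhds).hasDerivAt
  rw [hval] at htsum
  have hz : HasDerivAt (fun s ↦ riemannZeta₁ (s + 1)) (Real.eulerMascheroniConstant : ℂ) 0 := by
    apply HasDerivAt.comp_add_const
    rw [zero_add, ← deriv_riemannZeta₁_one]
    exact (differentiable_riemannZeta₁ 1).hasDerivAt
  refine HasDerivAt.congr_of_eventuallyEq ?_
    (Filter.eventuallyEq_of_mem hnhds (hurwitzZeta_sub_riemannZeta_eqOn ha))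
  convert! ((hasDerivAt_const_cpow_neg ha0 0).sub (hz.const_mul (a : ℂ))).add htsum using 1
  rw [ofReal_add, ofReal_add, ofReal_log ha.1.le]
  simp

lemma hurwitzZeta_sub_riemannZeta_zero {a : ℝ} (ha : a ∈ Set.Ioc 0 1) :
    hurwitzZeta a 0 - riemannZeta 0 = 1 - a := by
  simpa [hurwitzRemainder_zero] using hurwitzZeta_sub_riemannZeta_eqOn ha zero_mem_hurwitzDomain

lemma DirichletCharacter.apply_two_eq_neg_one {χ : DirichletCharacter ℂ 3} (hχ : χ ≠ 1) :
    χ 2 = -1 := by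
  have hsq : χ 2 * χ 2 = 1 := by
    rw [← map_mul, show (2 : ZMod 3) * 2 = 1 from rfl, map_one]
  refine (mul_self_eq_one_iff.mp hsq).resolve_left fun h ↦ hχ ?_
  rw [MulChar.eq_one_iff]
  intro u
  have hu : (u : ZMod 3) = 1 ∨ (u : ZMod 3) = 2 := by
    revert u
    decide
  rcases hu with hu | hu <;> simp [hu, h]

lemma DirichletCharacter.LFunction_three_eq {χ : DirichletCharacter ℂ 3} (hχ : χ ≠ 1) (s : ℂ) :
    LFunction χ s = 3 ^ (-s) *
      (hurwitzZeta ((1 / 3 : ℝ) : UnitAddCircle) s -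
        hurwitzZeta ((2 / 3 : ℝ) : UnitAddCircle) s) := by
  have h0 : χ 0 = 0 := χ.map_nonunit not_isUnit_zero
  have hv : (2 : ZMod 3).val = 2 := rfl
  have huniv : (Finset.univ : Finset (ZMod 3)) = {0, 1, 2} := rfl
  have hsum (f : ZMod 3 → ℂ) : ∑ j, f j = f 0 + f 1 + f 2 := by
    rw [huniv, Finset.sum_insert (by decide), Finset.sum_insert (by decide),
      Finset.sum_singleton, add_assoc]
  rw [DirichletCharacter.LFunction, ZMod.LFunction, hsum, h0, map_one, apply_two_eq_neg_one hχ]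
  simp [ZMod.toAddCircle_apply, hv, ZMod.val_one]
  ring_nf

lemma DirichletCharacter.LFunction_three_zero {χ : DirichletCharacter ℂ 3} (hχ : χ ≠ 1) :
    LFunction χ 0 = 1 / 3 := by
  have h1 := hurwitzZeta_sub_riemannZeta_zero (a := 1 / 3) (by norm_num)
  have h2 := hurwitzZeta_sub_riemannZeta_zero (a := 2 / 3) (by norm_num)
  rw [LFunction_three_eq hχ, neg_zero, cpow_zero, one_mul]
  push_cast at h1 h2
  linear_combination h1 - h2

lemma DirichletCharacter.hasDerivAt_LFunction_three_zero {χ : DirichletCharacter ℂ 3}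
    (hχ : χ ≠ 1) :
    HasDerivAt (LFunction χ)
      ((Real.log (Real.Gamma (1 / 3)) - Real.log (Real.Gamma (2 / 3)) - Real.log 3 / 3 : ℝ) : ℂ)
      0 := by
  have h1 := hasDerivAt_hurwitzZeta_sub_riemannZeta_zero (a := 1 / 3) (by norm_num)
  have h2 := hasDerivAt_hurwitzZeta_sub_riemannZeta_zero (a := 2 / 3) (by norm_num)
  have e1 := hurwitzZeta_sub_riemannZeta_zero (a := 1 / 3) (by norm_num)
  have e2 := hurwitzZeta_sub_riemannZeta_zero (a := 2 / 3) (by norm_num)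
  have h := (hasDerivAt_const_cpow_neg (c := 3) (by norm_num) 0).mul (h1.sub h2)
  refine (h.congr_of_eventuallyEq (.of_forall fun s ↦ ?_)).congr_deriv ?_
  · simp [LFunction_three_eq hχ]
  · simp only [Pi.sub_apply, e1, e2]
    have h3 : log (3 : ℂ) = (Real.log 3 : ℝ) := by
      rw [ofReal_log (by norm_num), ofReal_ofNat]
    rw [h3]
    push_cast
    simp
    ring

lemma log_Gamma_one_sixth :
    Real.log (Real.Gamma (1 / 6)) = 2 / 3 * Real.log 2 + Real.log π / 2 +
      Real.log (Real.Gamma (1 / 3)) - Real.log (Real.Gamma (2 / 3)) := by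
  have h := congrArg Real.log (Real.Gamma_mul_Gamma_add_half (1 / 6))
  have hp {x : ℝ} (hx : 0 < x) : Real.Gamma x ≠ 0 := (Real.Gamma_pos_of_pos hx).ne'
  norm_num at h
  rw [Real.log_mul (hp (by norm_num)) (hp (by norm_num)),
    Real.log_mul (mul_ne_zero (hp (by norm_num)) (by positivity)) (by positivity),
    Real.log_mul (hp (by norm_num)) (by positivity), Real.log_rpow (by norm_num),
    Real.log_sqrt Real.pi_pos.le] at h
  linarith

/-- The Epstein zeta function of the triangular lattice of covolume 1, expressed as
`F(s) = 3·(2/√3)^{−s/2}·ζ(s/2)·L(s/2, χ₃)`, is differentiable at `s = 0` with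
`F′(0) = (1/8)·log(48π/Γ(1/6)⁶)`; this is the Jellium energy density of the triangular
lattice configuration in dimension 2. -/
theorem triangular_lattice_energy (χ : DirichletCharacter ℂ 3) (hχ : χ ≠ 1) :
    HasDerivAt (fun s : ℂ =>
        3 * ((2 / Real.sqrt 3 : ℝ) : ℂ) ^ (-s / 2) * riemannZeta (s / 2) *
          DirichletCharacter.LFunction χ (s / 2))
      (((1 / 8 : ℝ) * Real.log (48 * π / (Real.Gamma (1 / 6)) ^ 6) : ℝ) : ℂ) 0 := by
  have h2 : HasDerivAt (fun s : ℂ ↦ s / 2) (1 / 2) 0 := (hasDerivAt_id 0).div_const 2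
  have hc : ((2 / Real.sqrt 3 : ℝ) : ℂ) ≠ 0 := ofReal_ne_zero.mpr (by positivity)
  have hlogc : log ((2 / Real.sqrt 3 : ℝ) : ℂ) = ((Real.log 2 - Real.log 3 / 2 : ℝ) : ℂ) := by
    rw [← ofReal_log (by positivity), Real.log_div (by norm_num) (by positivity),
      Real.log_sqrt (by norm_num)]
  have hlogpi : log (2 * π) = ((Real.log 2 + Real.log π : ℝ) : ℂ) := by
    rw [← Real.log_mul (by norm_num) Real.pi_ne_zero, ofReal_log (by positivity)]
    push_cast
    rfl
  have hP : HasDerivAt (fun s : ℂ ↦ 3 * ((2 / Real.sqrt 3 : ℝ) : ℂ) ^ (-s / 2))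
      (3 * (-((Real.log 2 - Real.log 3 / 2 : ℝ) : ℂ) / 2)) 0 := by
    have h := ((hasDerivAt_neg (0 : ℂ)).div_const 2).const_cpow (Or.inl hc)
    refine (h.const_mul 3).congr_deriv ?_
    rw [hlogc]
    simp
    ring
  have hZ : HasDerivAt (fun s : ℂ ↦ riemannZeta (s / 2))
      (-((Real.log 2 + Real.log π : ℝ) : ℂ) / 2 * (1 / 2)) 0 := by
    refine HasDerivAt.comp (h₂ := riemannZeta) 0 ?_ h2
    rw [zero_div, ← hlogpi, ← deriv_riemannZeta_zero]
    exact (differentiableAt_riemannZeta zero_ne_one).hasDerivAt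
  have hL := HasDerivAt.comp (h₂ := DirichletCharacter.LFunction χ) 0
    (by rw [zero_div]; exact DirichletCharacter.hasDerivAt_LFunction_three_zero hχ) h2
  refine ((hP.mul hZ).mul hL).congr_deriv ?_
  have hlog : Real.log (48 * π / Real.Gamma (1 / 6) ^ 6) =
      4 * Real.log 2 + Real.log 3 + Real.log π - 6 * Real.log (Real.Gamma (1 / 6)) := by
    have hG := Real.Gamma_pos_of_pos (show (0 : ℝ) < 1 / 6 by norm_num)
    rw [Real.log_div (by positivity) (by positivity), Real.log_mul (by norm_num) Real.pi_ne_zero,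
      Real.log_pow, show (48 : ℝ) = 2 ^ 4 * 3 by norm_num,
      Real.log_mul (by norm_num) (by norm_num), Real.log_pow]
    push_cast
    ring
  rw [hlog, log_Gamma_one_sixth]
  simp only [Pi.mul_apply, Function.comp_apply, zero_div, neg_zero, cpow_zero, riemannZeta_zero,
    DirichletCharacter.LFunction_three_zero hχ]
  push_cast
  ring
end
end

section
/- Let f : ℝ² → ℝ be a Schwartz function with ∫_{ℝ²} f(x) dx = 0. Then D(f) := −(1/2) ∬_{ℝ²×ℝ²} log|x−y| f(x) f(y) dx dy ≥ 0. -/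
open MeasureTheory

noncomputable section

theorem integrableOn_inv_mul_exp_sub_exp_of_le {a b : ℝ} (ha : 0 < a) (hab : a ≤ b) :
    IntegrableOn (fun t : ℝ => t⁻¹ • (Real.exp (-(a * t)) - Real.exp (-(b * t)))) (Set.Ioi 0) := by
  have hdom : IntegrableOn (fun t : ℝ => (b - a) * Real.exp (-a * t)) (Set.Ioi 0) :=
    (integrableOn_exp_mul_Ioi (neg_lt_zero.mpr ha) 0).const_mul _
  refine Integrable.mono' hdom (by fun_prop) ?_
  filter_upwards [ae_restrict_mem measurableSet_Ioi] with t ht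
  have ht : 0 < t := ht
  have hfac : Real.exp (-(b * t)) = Real.exp (-a * t) * Real.exp (-((b - a) * t)) := by
    rw [← Real.exp_add]; ring_nf
  have hle : Real.exp (-(b * t)) ≤ Real.exp (-(a * t)) :=
    Real.exp_le_exp.mpr (by nlinarith)
  rw [smul_eq_mul, Real.norm_of_nonneg (mul_nonneg (inv_nonneg.mpr ht.le) (sub_nonneg.mpr hle)),
    hfac, ← neg_mul, inv_mul_le_iff₀ ht]
  nlinarith [Real.add_one_le_exp (-((b - a) * t)), Real.exp_pos (-a * t)]

theorem integrableOn_inv_mul_exp_sub_exp {a b : ℝ} (ha : 0 < a) (hb : 0 < b) :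
    IntegrableOn (fun t : ℝ => t⁻¹ • (Real.exp (-(a * t)) - Real.exp (-(b * t)))) (Set.Ioi 0) := by
  rcases le_total a b with hab | hab
  · exact integrableOn_inv_mul_exp_sub_exp_of_le ha hab
  · convert (integrableOn_inv_mul_exp_sub_exp_of_le hb hab).neg using 1
    ext t
    simp only [Pi.neg_apply, smul_eq_mul]
    ring

theorem integral_inv_mul_exp_sub_exp {a b : ℝ} (ha : 0 < a) (hb : 0 < b) :
    ∫ t in Set.Ioi (0 : ℝ), t⁻¹ • (Real.exp (-(a * t)) - Real.exp (-(b * t))) =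
      Real.log (b / a) := by
  have hcont : Continuous fun t : ℝ => Real.exp (-t) := by fun_prop
  have h := Frullani.integral_Ioi_eq (f := fun t : ℝ => Real.exp (-t)) (L := 1) (R := 0)
    (hcont.locallyIntegrable.locallyIntegrableOn _) ha hb
    ((hcont.tendsto' 0 1 (by simp)).mono_left nhdsWithin_le_nhds)
    Real.tendsto_exp_neg_atTop_nhds_zero (integrableOn_inv_mul_exp_sub_exp ha hb)
  simpa using h

theorem integral_norm_inv_mul_exp_sub_exp {a b : ℝ} (ha : 0 < a) (hb : 0 < b) :
    ∫ t in Set.Ioi (0 : ℝ), ‖t⁻¹ • (Real.exp (-(a * t)) - Real.exp (-(b * t)))‖ =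
      |Real.log (b / a)| := by
  rw [← integral_inv_mul_exp_sub_exp ha hb]
  rcases le_total a b with hab | hab
  · have hnn : ∀ t ∈ Set.Ioi (0 : ℝ),
        0 ≤ t⁻¹ • (Real.exp (-(a * t)) - Real.exp (-(b * t))) := fun t (ht : 0 < t) =>
      mul_nonneg (inv_nonneg.mpr ht.le)
        (sub_nonneg.mpr (Real.exp_le_exp.mpr (by nlinarith)))
    rw [abs_of_nonneg (setIntegral_nonneg measurableSet_Ioi hnn)]
    exact setIntegral_congr_fun measurableSet_Ioi fun t ht => Real.norm_of_nonneg (hnn t ht)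
  · have hnp : ∀ t ∈ Set.Ioi (0 : ℝ),
        t⁻¹ • (Real.exp (-(a * t)) - Real.exp (-(b * t))) ≤ 0 := fun t (ht : 0 < t) =>
      mul_nonpos_of_nonneg_of_nonpos (inv_nonneg.mpr ht.le)
        (sub_nonpos.mpr (Real.exp_le_exp.mpr (by nlinarith)))
    rw [abs_of_nonpos (setIntegral_nonpos measurableSet_Ioi hnp), ← integral_neg]
    exact setIntegral_congr_fun measurableSet_Ioi fun t ht => Real.norm_of_nonpos (hnp t ht)

section Gaussian

variable {V : Type*} [NormedAddCommGroup V] [InnerProductSpace ℝ V]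

theorem exp_mul_exp_eq_exp_mul_exp_midpoint (t : ℝ) (x y z : V) :
    Real.exp (-(2 * t) * ‖x - z‖ ^ 2) * Real.exp (-(2 * t) * ‖y - z‖ ^ 2) =
      Real.exp (-t * ‖x - y‖ ^ 2) *
        Real.exp (-(4 * t) * ‖z - (2⁻¹ : ℝ) • (x + y)‖ ^ 2) := by
  have hpar := parallelogram_law_with_norm ℝ (x - z) (y - z)
  have h1 : x - z + (y - z) = (-2 : ℝ) • (z - (2⁻¹ : ℝ) • (x + y)) := by module
  have h2 : x - z - (y - z) = x - y := by abel
  have h3 : ‖(-2 : ℝ)‖ = 2 := by norm_num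
  rw [h1, h2, norm_smul, h3] at hpar
  rw [← Real.exp_add, ← Real.exp_add]
  congr 1
  linear_combination t * hpar

variable [FiniteDimensional ℝ V] [MeasurableSpace V] [BorelSpace V]

theorem integral_rexp_neg_mul_sq_norm_pos {b : ℝ} (hb : 0 < b) :
    0 < ∫ v : V, Real.exp (-b * ‖v‖ ^ 2) := by
  rw [GaussianFourier.integral_rexp_neg_mul_sq_norm hb]
  positivity

theorem integrable_rexp_neg_mul_sq_norm {b : ℝ} (hb : 0 < b) :
    Integrable fun v : V => Real.exp (-b * ‖v‖ ^ 2) :=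
  Integrable.of_integral_ne_zero (integral_rexp_neg_mul_sq_norm_pos hb).ne'

/-- The Gaussian kernel is positive semidefinite. -/
theorem integral_gaussian_mul_mul_nonneg {f : V → ℝ} (hf : Integrable f) {t : ℝ} (ht : 0 < t) :
    0 ≤ ∫ p : V × V, Real.exp (-t * ‖p.1 - p.2‖ ^ 2) * (f p.1 * f p.2) := by
  set C := ∫ v : V, Real.exp (-(4 * t) * ‖v‖ ^ 2)
  have h4 : 0 < 4 * t := by positivity
  have hCpos : 0 < C := integral_rexp_neg_mul_sq_norm_pos h4
  have hff : Integrable (fun p : V × V => f p.1 * f p.2) := hf.mul_prod hf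
  let G : V × V → V → ℝ := fun p z =>
    Real.exp (-(2 * t) * ‖p.1 - z‖ ^ 2) * Real.exp (-(2 * t) * ‖p.2 - z‖ ^ 2) * (f p.1 * f p.2)
  have hG : ∀ p z, G p z = Real.exp (-t * ‖p.1 - p.2‖ ^ 2) * (f p.1 * f p.2) *
      Real.exp (-(4 * t) * ‖z - (2⁻¹ : ℝ) • (p.1 + p.2)‖ ^ 2) := fun p z => by
    simp only [G, exp_mul_exp_eq_exp_mul_exp_midpoint]; ring
  have hGint : ∀ c : V, ∫ z, Real.exp (-(4 * t) * ‖z - c‖ ^ 2) = C := fun c =>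
    integral_sub_right_eq_self (fun v : V => Real.exp (-(4 * t) * ‖v‖ ^ 2)) c
  have hker : Integrable (fun p : V × V => Real.exp (-t * ‖p.1 - p.2‖ ^ 2) * (f p.1 * f p.2)) :=
    hff.bdd_mul (c := 1) (by fun_prop) (ae_of_all _ fun p => by
      rw [Real.norm_of_nonneg (Real.exp_pos _).le, Real.exp_le_one_iff]
      nlinarith [sq_nonneg ‖p.1 - p.2‖])
  have hint : Integrable (Function.uncurry G) ((volume : Measure (V × V)).prod volume) := by
    refine (integrable_prod_iff ?_).mpr ⟨ae_of_all _ fun p => ?_, ?_⟩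
    · exact AEStronglyMeasurable.mul (by fun_prop) hff.aestronglyMeasurable.comp_fst
    · simp only [Function.uncurry_apply_pair, hG]
      exact ((integrable_rexp_neg_mul_sq_norm h4).comp_sub_right _).const_mul _
    · simp only [Function.uncurry_apply_pair, hG, norm_mul _ (Real.exp (-(4 * t) * _)),
        integral_const_mul, Real.norm_of_nonneg (Real.exp_pos (-(4 * t) * _)).le, hGint]
      exact hker.norm.mul_const _
  have hswap := integral_integral_swap hint
  have hleft : ∫ p : V × V, ∫ z, G p z =
      (∫ p : V × V, Real.exp (-t * ‖p.1 - p.2‖ ^ 2) * (f p.1 * f p.2)) * C := by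
    simp only [hG, integral_const_mul, hGint, integral_mul_const]
  have hright : ∀ z, ∫ p : V × V, G p z =
      (∫ x, Real.exp (-(2 * t) * ‖x - z‖ ^ 2) * f x) ^ 2 := fun z => by
    rw [sq, ← integral_prod_mul, ← Measure.volume_eq_prod]
    congr 1 with p
    simp only [G]; ring
  refine nonneg_of_mul_nonneg_left ?_ hCpos
  rw [← hleft, hswap]
  exact integral_nonneg fun z => by simp only [hright]; positivity

end Gaussian

theorem integrableOn_log_norm_ball :
    IntegrableOn (fun u : E2 => Real.log ‖u‖) (Metric.ball 0 1) := by
  rw [integrableOn_fun_norm_addHaar]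
  have h : IntegrableOn (fun y : ℝ => y * Real.log y) (Set.Ioo 0 1) :=
    (Real.continuous_mul_log.continuousOn.integrableOn_Icc).mono_set Set.Ioo_subset_Icc_self
  simpa using h

/-- The logarithmic Coulomb integrand of a Schwartz charge density is absolutely integrable. -/
theorem SchwartzMap.integrable_log_norm_sub_mul (f : SchwartzMap E2 ℝ) :
    Integrable (fun p : E2 × E2 => Real.log ‖p.1 - p.2‖ * (f p.1 * f p.2)) := by
  let g : E2 → ℝ := (Metric.ball 0 1).indicator fun u => Real.log ‖u‖
  have hg : Integrable g := integrableOn_log_norm_ball.integrable_indicator measurableSet_ball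
  obtain ⟨C, hC⟩ : ∃ C : ℝ, ∀ x, ‖f x‖ ≤ C := ⟨_, f.norm_le_seminorm ℝ⟩
  have h1 : Integrable (fun p : E2 × E2 => f p.2 * g (p.1 - p.2)) :=
    f.integrable.convolution_integrand (ContinuousLinearMap.mul ℝ ℝ) hg
  have hf1 : Integrable fun x => ‖x‖ * ‖f x‖ := by simpa using f.integrable_pow_mul volume 1
  have hf0 : Integrable fun x => ‖f x‖ := f.integrable.norm
  have h2 : Integrable (fun p : E2 × E2 => (‖p.1‖ * ‖f p.1‖) * ‖f p.2‖) := hf1.mul_prod hf0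
  have h3 : Integrable (fun p : E2 × E2 => ‖f p.1‖ * (‖p.2‖ * ‖f p.2‖)) := hf0.mul_prod hf1
  refine Integrable.mono' ((h1.norm.const_mul C).add (h2.add h3)) ?_ (ae_of_all _ fun p => ?_)
  · exact (Measurable.aestronglyMeasurable (by fun_prop)).mul
      (Continuous.aestronglyMeasurable (by fun_prop))
  obtain ⟨x, y⟩ := p
  have hlog : ‖Real.log ‖x - y‖‖ ≤ ‖g (x - y)‖ + (‖x‖ + ‖y‖) := by
    by_cases hxy : x - y ∈ Metric.ball (0 : E2) 1
    · simp only [g, Set.indicator_of_mem hxy]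
      exact le_add_of_nonneg_right (by positivity)
    · have h1 : 1 ≤ ‖x - y‖ := by simpa using hxy
      rw [Real.norm_of_nonneg (Real.log_nonneg h1)]
      linarith [Real.log_le_self (zero_le_one.trans h1), norm_sub_le x y, norm_nonneg (g (x - y))]
  simp only [norm_mul, Pi.add_apply]
  calc ‖Real.log ‖x - y‖‖ * (‖f x‖ * ‖f y‖)
      ≤ (‖g (x - y)‖ + (‖x‖ + ‖y‖)) * (‖f x‖ * ‖f y‖) := by gcongr
    _ = ‖f x‖ * (‖f y‖ * ‖g (x - y)‖) +
        (‖x‖ * ‖f x‖ * ‖f y‖ + ‖f x‖ * (‖y‖ * ‖f y‖)) := by ring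
    _ ≤ C * (‖f y‖ * ‖g (x - y)‖) +
        (‖x‖ * ‖f x‖ * ‖f y‖ + ‖f x‖ * (‖y‖ * ‖f y‖)) := by gcongr; exact hC x

/-- For a Schwartz function `f` on `ℝ²` with `∫ f = 0`, the 2D Coulomb self-energy
`D(f) = −(1/2) ∬ log|x−y| f(x) f(y) dx dy` is nonnegative. -/
theorem coulomb_energy_nonneg (f : SchwartzMap E2 ℝ) (hf : (∫ x : E2, f x) = 0) :
    0 ≤ -((1 / 2) * ∫ x : E2, ∫ y : E2, Real.log ‖x - y‖ * f x * f y) := by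
  have hL := f.integrable_log_norm_sub_mul
  have hff : Integrable (fun p : E2 × E2 => f p.1 * f p.2) := f.integrable.mul_prod f.integrable
  have hff0 : ∫ p : E2 × E2, f p.1 * f p.2 = 0 := by
    rw [Measure.volume_eq_prod, integral_prod_mul, hf, zero_mul]
  have hiter : ∫ x : E2, ∫ y : E2, Real.log ‖x - y‖ * f x * f y =
      ∫ p : E2 × E2, Real.log ‖p.1 - p.2‖ * (f p.1 * f p.2) := by
    rw [Measure.volume_eq_prod, integral_prod _ hL]
    simp only [mul_assoc]
  let k : E2 × E2 → ℝ → ℝ := fun p t =>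
    t⁻¹ • (Real.exp (-(‖p.1 - p.2‖ ^ 2 * t)) - Real.exp (-(1 * t))) * (f p.1 * f p.2)
  have hne : ∀ᵐ p : E2 × E2, 0 < ‖p.1 - p.2‖ ^ 2 := by
    have h0 : ∀ᵐ p : E2 × E2, p.1 - p.2 ≠ 0 :=
      (quasiMeasurePreserving_sub_of_right_invariant (volume : Measure E2) volume).ae
        (Measure.ae_ne volume 0)
    filter_upwards [h0] with p hp
    have := norm_pos_iff.mpr hp
    positivity
  have hlog : ∀ p : E2 × E2, Real.log (1 / ‖p.1 - p.2‖ ^ 2) = -2 * Real.log ‖p.1 - p.2‖ :=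
    fun p => by rw [one_div, Real.log_inv, Real.log_pow]; push_cast; ring
  have hk : ∀ᵐ p : E2 × E2, ∫ t in Set.Ioi 0, k p t =
      -2 * (Real.log ‖p.1 - p.2‖ * (f p.1 * f p.2)) := by
    filter_upwards [hne] with p hp
    simp only [k]
    rw [integral_mul_const, integral_inv_mul_exp_sub_exp hp one_pos, hlog]
    ring
  have hkint : Integrable (Function.uncurry k)
      ((volume : Measure (E2 × E2)).prod (volume.restrict (Set.Ioi 0))) := by
    refine (integrable_prod_iff ?_).mpr ⟨?_, ?_⟩
    · exact (Measurable.aestronglyMeasurable (by fun_prop)).mul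
        (Continuous.aestronglyMeasurable (by fun_prop))
    · filter_upwards [hne] with p hp
      exact (integrableOn_inv_mul_exp_sub_exp hp one_pos).mul_const (f p.1 * f p.2)
    · refine (hL.norm.const_mul 2).congr ?_
      filter_upwards [hne] with p hp
      simp only [Function.uncurry_apply_pair, k]
      simp_rw [norm_mul _ (f p.1 * f p.2)]
      rw [integral_mul_const, integral_norm_inv_mul_exp_sub_exp hp one_pos, hlog, norm_mul,
        abs_mul, Real.norm_eq_abs (Real.log _)]
      norm_num
      ring
  have hpos : 0 ≤ ∫ p : E2 × E2, ∫ t in Set.Ioi 0, k p t := by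
    rw [integral_integral_swap hkint]
    refine setIntegral_nonneg measurableSet_Ioi fun t (ht : 0 < t) => ?_
    have hker : Integrable
        (fun p : E2 × E2 => Real.exp (-t * ‖p.1 - p.2‖ ^ 2) * (f p.1 * f p.2)) :=
      hff.bdd_mul (c := 1) (by fun_prop) (ae_of_all _ fun p => by
        rw [Real.norm_of_nonneg (Real.exp_pos _).le, Real.exp_le_one_iff]
        nlinarith [sq_nonneg ‖p.1 - p.2‖])
    have hkt : ∀ p, k p t = t⁻¹ * (Real.exp (-t * ‖p.1 - p.2‖ ^ 2) * (f p.1 * f p.2) -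
        Real.exp (-t) * (f p.1 * f p.2)) := fun p => by
      simp only [k, smul_eq_mul, one_mul, neg_mul, mul_comm t]; ring
    simp only [hkt]
    rw [integral_const_mul, integral_sub hker (hff.const_mul _), integral_const_mul, hff0,
      mul_zero, sub_zero]
    exact mul_nonneg (inv_nonneg.mpr ht.le) (integral_gaussian_mul_mul_nonneg f.integrable ht)
  rw [integral_congr_ae hk, integral_const_mul, ← hiter] at hpos
  linarith
end
end

section
/- Let C₀, C₁, ℓ > 0. There is a constant C > 0 (depending only on C₀, C₁, ℓ) such that the following holds for every real N ≥ 2: if A ⊂ ℝ² is a square with area |A| ≤ C₀·N, B = {x ∈ ℝ² : dist(x, ∂A) ≤ ℓ} is the boundary strip of A of width ℓ, and μ is a positive Borel measure on ℝ² with μ(B_R(x₀)) ≤ C₁·R² for every ball of radius R ≥ 1, then ∫_A ∫_{B ∩ {y : |x−y| > 1}} |x−y|^{−2} dy dμ(x) ≤ C·N^{1/2}·log N. -/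
open MeasureTheory Real Filter Topology Metric Bornology
open scoped ENNReal

noncomputable section

/-- `A` is an (axis-parallel) open square in `ℝ²`. -/
def IsSquareSet (A : Set E2) : Prop :=
  ∃ (c : E2) (a : ℝ), 0 < a ∧ A = {x : E2 | ∀ i, |x i - c i| < a / 2}

/-- The kernel `|z|⁻²` cut off to `|z| > 1`. -/
def cutoffKernel (z : E2) : ℝ≥0∞ :=
  {z : E2 | 1 < ‖z‖}.indicator (fun z => ENNReal.ofReal (‖z‖ ^ 2)⁻¹) z

lemma measurableSet_one_lt_norm : MeasurableSet {z : E2 | 1 < ‖z‖} :=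
  measurableSet_lt measurable_const measurable_norm

lemma measurable_cutoffKernel : Measurable cutoffKernel :=
  Measurable.indicator (by fun_prop) measurableSet_one_lt_norm

lemma cutoffKernel_le_dyadic_sum {z : E2} {n : ℕ} (hz : ‖z‖ < 2 ^ n) :
    cutoffKernel z ≤ ∑ j ∈ Finset.range (n + 1),
      (Metric.ball (0 : E2) (2 ^ j)).indicator (fun _ => ENNReal.ofReal (4 * (4 ^ j)⁻¹)) z := by
  by_cases h1 : 1 < ‖z‖
  · obtain ⟨k, hk, hk'⟩ := exists_nat_pow_near h1.le (one_lt_two : (1 : ℝ) < 2)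
    have hkn : k < n := (pow_lt_pow_iff_right₀ (one_lt_two : (1 : ℝ) < 2)).1 (hk.trans_lt hz)
    have hmem : k + 1 ∈ Finset.range (n + 1) := by simp; omega
    refine le_trans ?_ (Finset.single_le_sum (fun _ _ => zero_le) hmem)
    rw [cutoffKernel, Set.indicator_of_mem (by exact h1),
      Set.indicator_of_mem (by simpa using hk')]
    refine ENNReal.ofReal_le_ofReal ?_
    have h4 : (4 : ℝ) * (4 ^ (k + 1))⁻¹ = ((2 ^ k) ^ 2)⁻¹ := by
      rw [← pow_mul, mul_comm k 2, pow_mul, pow_succ]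
      norm_num
      field_simp
    rw [h4]
    gcongr
  · rw [cutoffKernel, Set.indicator_of_notMem (by exact h1)]
    exact zero_le

/-- For a measure of at most quadratic growth, each dyadic annulus contributes a bounded amount
to the integral of the kernel. -/
lemma setLIntegral_cutoffKernel_le {C₁ : ℝ} {μ : Measure E2}
    (hμ : ∀ (x₀ : E2) (R : ℝ), 1 ≤ R → μ (Metric.ball x₀ R) ≤ ENNReal.ofReal (C₁ * R ^ 2))
    {A : Set E2} (hA : MeasurableSet A) (y : E2) {n : ℕ} (hn : ∀ x ∈ A, ‖x - y‖ < 2 ^ n) :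
    ∫⁻ x in A, cutoffKernel (x - y) ∂μ ≤ ENNReal.ofReal (4 * C₁ * (n + 1)) := by
  calc ∫⁻ x in A, cutoffKernel (x - y) ∂μ
      ≤ ∫⁻ x in A, ∑ j ∈ Finset.range (n + 1),
          (Metric.ball y (2 ^ j)).indicator (fun _ => ENNReal.ofReal (4 * (4 ^ j)⁻¹)) x ∂μ := by
        refine setLIntegral_mono' hA fun x hx => ?_
        refine (cutoffKernel_le_dyadic_sum (hn x hx)).trans_eq ?_
        refine Finset.sum_congr rfl fun j _ => ?_
        simp only [Set.indicator, Metric.mem_ball, dist_eq_norm, sub_zero]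
    _ ≤ ∫⁻ x, ∑ j ∈ Finset.range (n + 1),
          (Metric.ball y (2 ^ j)).indicator (fun _ => ENNReal.ofReal (4 * (4 ^ j)⁻¹)) x ∂μ :=
        setLIntegral_le_lintegral _ _
    _ = ∑ j ∈ Finset.range (n + 1),
          ENNReal.ofReal (4 * (4 ^ j)⁻¹) * μ (Metric.ball y (2 ^ j)) := by
        rw [lintegral_finsetSum _ fun j _ => measurable_const.indicator measurableSet_ball]
        exact Finset.sum_congr rfl fun j _ => lintegral_indicator_const measurableSet_ball _
    _ ≤ ∑ j ∈ Finset.range (n + 1), ENNReal.ofReal (4 * C₁) := by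
        refine Finset.sum_le_sum fun j _ => ?_
        grw [hμ y (2 ^ j) (one_le_pow₀ one_le_two)]
        rw [← ENNReal.ofReal_mul (by positivity), ← pow_mul, mul_comm j 2, pow_mul]
        refine ENNReal.ofReal_le_ofReal (le_of_eq ?_)
        norm_num
        field_simp
    _ = ENNReal.ofReal (4 * C₁ * (n + 1)) := by
        rw [Finset.sum_const, Finset.card_range, ← ENNReal.ofReal_nsmul, nsmul_eq_mul, mul_comm]
        push_cast
        rfl

lemma volume_coordinate_box (l u : Fin 2 → ℝ) :
    volume {x : E2 | ∀ i, x i ∈ Set.Icc (l i) (u i)} =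
      ENNReal.ofReal (u 0 - l 0) * ENNReal.ofReal (u 1 - l 1) := by
  have h : {x : E2 | ∀ i, x i ∈ Set.Icc (l i) (u i)} =
      (MeasurableEquiv.toLp 2 (Fin 2 → ℝ)).symm ⁻¹' Set.Icc l u := by
    ext x
    simp [Pi.le_def, forall_and]
  rw [h, (EuclideanSpace.volume_preserving_symm_measurableEquiv_toLp (Fin 2)).measure_preimage
    measurableSet_Icc.nullMeasurableSet, Real.volume_Icc_pi, Fin.prod_univ_two]

lemma volume_openSquare (c : E2) (a : ℝ) :
    volume {x : E2 | ∀ i, |x i - c i| < a / 2} = ENNReal.ofReal a * ENNReal.ofReal a := by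
  have h : {x : E2 | ∀ i, |x i - c i| < a / 2} =
      (MeasurableEquiv.toLp 2 (Fin 2 → ℝ)).symm ⁻¹'
        Set.univ.pi fun i => Set.Ioo (c i - a / 2) (c i + a / 2) := by
    ext x
    simp [abs_sub_lt_iff, sub_lt_iff_lt_add, add_comm, and_comm]
  rw [h, (EuclideanSpace.volume_preserving_symm_measurableEquiv_toLp (Fin 2)).measure_preimage
    (MeasurableSet.univ_pi fun _ => measurableSet_Ioo).nullMeasurableSet, volume_pi_pi,
    Fin.prod_univ_two]
  simp

lemma isOpen_openSquare (c : E2) (a : ℝ) : IsOpen {x : E2 | ∀ i, |x i - c i| < a / 2} := by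
  simp only [Set.ofPred_forall]
  exact isOpen_iInter_of_finite fun i => isOpen_lt (by fun_prop) continuous_const

lemma norm_le_two_mul {z : E2} {r : ℝ} (h : ∀ i, |z i| ≤ r) : ‖z‖ ≤ 2 * r := by
  have hr : 0 ≤ r := (abs_nonneg _).trans (h 0)
  rw [EuclideanSpace.norm_eq, Fin.sum_univ_two]
  refine Real.sqrt_le_iff.2 ⟨by positivity, ?_⟩
  have h0 : ‖z 0‖ ^ 2 ≤ r ^ 2 := by gcongr; exact h 0
  have h1 : ‖z 1‖ ^ 2 ≤ r ^ 2 := by gcongr; exact h 1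
  nlinarith [sq_nonneg r]

lemma frontier_openSquare_subset (c : E2) (a : ℝ) :
    frontier {x : E2 | ∀ i, |x i - c i| < a / 2} ⊆
      {x : E2 | (∀ i, |x i - c i| ≤ a / 2) ∧ ∃ i, |x i - c i| = a / 2} := by
  intro x hx
  have hcl : IsClosed {x : E2 | ∀ i, |x i - c i| ≤ a / 2} := by
    simp only [Set.ofPred_forall]
    exact isClosed_iInter fun i => isClosed_le (by fun_prop) continuous_const
  have h1 : x ∈ {x : E2 | ∀ i, |x i - c i| ≤ a / 2} :=
    closure_minimal (fun y hy i => (hy i).le) hcl hx.1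
  refine ⟨h1, ?_⟩
  have h2 := hx.2
  rw [(isOpen_openSquare c a).interior_eq] at h2
  simp only [Set.mem_ofPred_eq, not_forall, not_lt] at h2
  obtain ⟨i, hi⟩ := h2
  exact ⟨i, le_antisymm (h1 i) hi⟩

lemma frontier_openSquare_nonempty (c : E2) {a : ℝ} (ha : 0 < a) :
    (frontier {x : E2 | ∀ i, |x i - c i| < a / 2}).Nonempty := by
  refine nonempty_frontier_iff.2 ⟨⟨c, by simp [ha]⟩, fun h => ?_⟩
  have := Set.eq_univ_iff_forall.1 h (c + EuclideanSpace.single 0 a) 0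
  simp [abs_of_pos ha] at this
  linarith

/-- Points of the boundary strip of a square lie near one of its four sides. -/
lemma boundaryStrip_subset (c : E2) {a ℓ : ℝ} (ha : 0 < a) :
    {y : E2 | Metric.infDist y (frontier {x : E2 | ∀ i, |x i - c i| < a / 2}) ≤ ℓ} ⊆
      {y : E2 | (∀ i, |y i - c i| ≤ a / 2 + ℓ) ∧
        ∃ i, |y i - (c i + a / 2)| ≤ ℓ ∨ |y i - (c i - a / 2)| ≤ ℓ} := by
  intro y hy
  obtain ⟨z, hz, hyz⟩ :=
    isClosed_frontier.exists_infDist_eq_dist (frontier_openSquare_nonempty c ha) y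
  have hd : ∀ i, |y i - z i| ≤ ℓ := fun i => by
    have h := PiLp.norm_apply_le (y - z) i
    rw [← dist_eq_norm, ← hyz] at h
    exact h.trans hy
  obtain ⟨h1, i, hi⟩ := frontier_openSquare_subset c a hz
  refine ⟨fun j => ?_, i, ?_⟩
  · have := abs_sub_le (y j) (z j) (c j)
    linarith [hd j, h1 j]
  · rcases (abs_eq (by positivity)).1 hi with h | h
    · left; rw [show c i + a / 2 = z i by linarith]; exact hd i
    · right; rw [show c i - a / 2 = z i by linarith]; exact hd i

lemma volume_boundaryStrip_le (c : E2) {a ℓ : ℝ} (ha : 0 < a) (hℓ : 0 < ℓ) :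
    volume {y : E2 | Metric.infDist y (frontier {x : E2 | ∀ i, |x i - c i| < a / 2}) ≤ ℓ} ≤
      ENNReal.ofReal (8 * ℓ * (a + 2 * ℓ)) := by
  let Q (i : Fin 2) (s : ℝ) : Set E2 := {y : E2 | ∀ j, y j ∈
    Set.Icc (if j = i then c i + s - ℓ else c j - (a / 2 + ℓ))
      (if j = i then c i + s + ℓ else c j + (a / 2 + ℓ))}
  have hQ : ∀ i s, volume (Q i s) = ENNReal.ofReal (2 * ℓ * (a + 2 * ℓ)) := fun i s => by
    simp only [Q]
    rw [volume_coordinate_box, ← ENNReal.ofReal_mul (by split_ifs <;> linarith)]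
    congr 1
    fin_cases i <;> simp <;> ring
  have hsub : {y : E2 | Metric.infDist y (frontier {x : E2 | ∀ i, |x i - c i| < a / 2}) ≤ ℓ} ⊆
      (Q 0 (a / 2) ∪ Q 0 (-(a / 2))) ∪ (Q 1 (a / 2) ∪ Q 1 (-(a / 2))) := by
    intro y hy
    obtain ⟨h1, i, hi⟩ := boundaryStrip_subset c ha hy
    have key : y ∈ Q i (a / 2) ∪ Q i (-(a / 2)) := by
      refine hi.imp (fun h j => ?_) (fun h j => ?_) <;>
      · have hj := abs_le.1 (h1 j)
        have h' := abs_le.1 h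
        split_ifs with hji
        · subst hji
          constructor <;> linarith
        · constructor <;> linarith
    fin_cases i
    · exact Or.inl key
    · exact Or.inr key
  refine (measure_mono hsub).trans ?_
  grw [measure_union_le, measure_union_le, measure_union_le]
  simp only [hQ]
  have hp : 0 ≤ 2 * ℓ * (a + 2 * ℓ) := by positivity
  rw [← ENNReal.ofReal_add hp hp, ← ENNReal.ofReal_add (by positivity) (by positivity)]
  exact ENNReal.ofReal_le_ofReal (le_of_eq (by ring))

lemma dyadic_count_le {K N : ℝ} {n : ℕ} (hK : 1 ≤ K) (hN : 2 ≤ N) (hn : 2 ^ n ≤ K * √N) :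
    (n : ℝ) + 2 ≤ (Real.log K / Real.log 2 + 3) / Real.log 2 * Real.log N := by
  have hL : 0 < Real.log 2 := Real.log_pos one_lt_two
  have hLN : Real.log 2 ≤ Real.log N := Real.log_le_log two_pos hN
  have hLK : 0 ≤ Real.log K := Real.log_nonneg hK
  have h1 : n * Real.log 2 ≤ Real.log K + Real.log N / 2 := by
    have h := Real.log_le_log (by positivity) hn
    rwa [Real.log_pow, Real.log_mul (by positivity) (by positivity),
      Real.log_sqrt (by positivity)] at h
  have h2 : Real.log K ≤ Real.log K / Real.log 2 * Real.log N := by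
    rw [div_mul_eq_mul_div, le_div_iff₀ hL]
    gcongr
  rw [div_mul_eq_mul_div, le_div_iff₀ hL]
  linarith

/-- For a square `A` of area `O(N)`, its boundary strip `B` of width `ℓ`, and a measure
`μ` with at most quadratic growth, `∫_A ∫_{B ∩ {|x−y|>1}} |x−y|⁻² dy dμ(x)` is
`O(N^{1/2} log N)`. -/
theorem boundary_strip_bound (C₀ C₁ ℓ : ℝ) (hC₀ : 0 < C₀) (hC₁ : 0 < C₁) (hℓ : 0 < ℓ) :
    ∃ C : ℝ, 0 < C ∧ ∀ N : ℝ, 2 ≤ N → ∀ A : Set E2, IsSquareSet A →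
      volume A ≤ ENNReal.ofReal (C₀ * N) →
      ∀ μ : Measure E2,
        (∀ (x₀ : E2) (R : ℝ), 1 ≤ R → μ (Metric.ball x₀ R) ≤ ENNReal.ofReal (C₁ * R ^ 2)) →
        (∫⁻ x in A,
            (∫⁻ y in {y : E2 | Metric.infDist y (frontier A) ≤ ℓ} ∩ {y : E2 | 1 < ‖x - y‖},
              ENNReal.ofReal (‖x - y‖ ^ 2)⁻¹) ∂μ)
          ≤ ENNReal.ofReal (C * N ^ ((1 : ℝ) / 2) * Real.log N) := by
  set K : ℝ := 2 * (√C₀ + ℓ + 1) with hK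
  have hK1 : 1 ≤ K := by have := Real.sqrt_nonneg C₀; linarith
  set M : ℝ := (Real.log K / Real.log 2 + 3) / Real.log 2 with hM
  have hMpos : 0 < M := by
    have hL : 0 < Real.log 2 := Real.log_pos one_lt_two
    have hLK : 0 ≤ Real.log K := Real.log_nonneg hK1
    positivity
  refine ⟨4 * C₁ * M * (8 * ℓ * K), by positivity, ?_⟩
  rintro N hN A ⟨c, a, ha, rfl⟩ hvol μ hμ
  set A : Set E2 := {x : E2 | ∀ i, |x i - c i| < a / 2} with hA
  set B : Set E2 := {y : E2 | Metric.infDist y (frontier A) ≤ ℓ} with hB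
  have hsN : 1 ≤ √N := Real.one_le_sqrt.2 (by linarith)
  have hlogN : 0 < Real.log N := Real.log_pos (by linarith)
  have haN : a ≤ √C₀ * √N := by
    rw [hA, volume_openSquare, ← ENNReal.ofReal_mul ha.le,
      ENNReal.ofReal_le_ofReal_iff (by positivity)] at hvol
    rw [← Real.sqrt_mul hC₀.le]
    exact Real.le_sqrt_of_sq_le (by rwa [sq])
  have hmA : MeasurableSet A := (isOpen_openSquare c a).measurableSet
  have hmB : MeasurableSet B :=
    (isClosed_le (Metric.continuous_infDist_pt _) continuous_const).measurableSet
  have hfin : IsFiniteMeasure (μ.restrict A) := by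
    refine ⟨?_⟩
    rw [Measure.restrict_apply_univ]
    refine (measure_mono (t := Metric.ball c (a + 1)) fun x hx => ?_).trans_lt
      ((hμ c (a + 1) (by linarith)).trans_lt ENNReal.ofReal_lt_top)
    rw [Metric.mem_ball, dist_eq_norm]
    have := norm_le_two_mul (z := x - c) (r := a / 2) fun i => (hx i).le
    linarith
  obtain ⟨n, hn, hn'⟩ := exists_nat_pow_near (one_le_mul_of_one_le_of_one_le hK1 hsN)
    (one_lt_two : (1 : ℝ) < 2)
  have hinner : ∀ y ∈ B, ∫⁻ x in A, cutoffKernel (x - y) ∂μ ≤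
      ENNReal.ofReal (4 * C₁ * (M * Real.log N)) := fun y hy => by
    refine (setLIntegral_cutoffKernel_le hμ hmA y (n := n + 1) fun x hx => ?_).trans ?_
    · refine lt_of_le_of_lt ?_ hn'
      have hyc := (boundaryStrip_subset c ha hy).1
      have := norm_le_two_mul (z := x - y) (r := a + ℓ) fun i => by
        have := abs_sub_le (x i) (c i) (y i)
        rw [abs_sub_comm (c i)] at this
        have hxi := hx i
        simp only [PiLp.sub_apply]
        linarith [hyc i]
      nlinarith
    · refine ENNReal.ofReal_le_ofReal ?_
      have := dyadic_count_le hK1 hN hn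
      push_cast
      gcongr
      linarith
  calc _ = ∫⁻ x in A, (∫⁻ y in B, cutoffKernel (x - y)) ∂μ := by
        refine lintegral_congr fun x => ?_
        have hm : MeasurableSet {y : E2 | 1 < ‖x - y‖} :=
          measurableSet_lt measurable_const (by fun_prop)
        rw [Set.inter_comm, ← Measure.restrict_restrict hm, ← lintegral_indicator hm]
        rfl
    _ = ∫⁻ y in B, ∫⁻ x in A, cutoffKernel (x - y) ∂μ := by
        refine lintegral_lintegral_swap (Measurable.aemeasurable ?_)
        exact measurable_cutoffKernel.comp (measurable_fst.sub measurable_snd)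
    _ ≤ ∫⁻ y in B, ENNReal.ofReal (4 * C₁ * (M * Real.log N)) := setLIntegral_mono' hmB hinner
    _ = ENNReal.ofReal (4 * C₁ * (M * Real.log N)) * volume B := setLIntegral_const _ _
    _ ≤ ENNReal.ofReal (4 * C₁ * (M * Real.log N)) * ENNReal.ofReal (8 * ℓ * (a + 2 * ℓ)) := by
        grw [volume_boundaryStrip_le c ha hℓ]
    _ ≤ _ := by
        rw [← ENNReal.ofReal_mul (by positivity), ← Real.sqrt_eq_rpow]
        refine ENNReal.ofReal_le_ofReal ?_
        have h : a + 2 * ℓ ≤ K * √N := by nlinarith [Real.sqrt_nonneg C₀]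
        calc _ ≤ 4 * C₁ * (M * Real.log N) * (8 * ℓ * (K * √N)) := by gcongr
          _ = _ := by ring
end
end

section
/- Let C₀, C₁, ℓ > 0. There is a constant C > 0 (depending only on C₀, C₁, ℓ) such that the following holds for every real N ≥ 2: if A ⊂ ℝ² is a square with area |A| ≤ C₀·N, B = {x ∈ ℝ² : dist(x, ∂A) ≤ ℓ}, μ is a Borel probability measure supported in the closed ball of radius ℓ centered at 0, τ = ∫ a dμ(a) is its first moment, and b : ℝ² → ℝ is measurable with |b| ≤ C₁ and b supported in B, then |D(1_{A+τ} − 1_A ∗ μ, b)| ≤ C·N^{1/2}·log N. -/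
open MeasureTheory Real Filter Topology Metric Bornology
open scoped ENNReal

noncomputable section

/-- The 2D Coulomb interaction `D(f, g) = (1/2) ∬ (−log|x−y|) f(x) g(y) dx dy`. -/
def Dpair (f g : E2 → ℝ) : ℝ :=
  (1 / 2) * ∫ x : E2, ∫ y : E2, -Real.log ‖x - y‖ * f x * g y


lemma locallyIntegrable_log_norm : LocallyIntegrable (fun w : E2 => log ‖w‖) := by
  have key : ∀ R : ℝ, IntegrableOn (fun w : E2 => log ‖w‖) (closedBall 0 R) := by
    intro R
    have h : Integrable (fun w : E2 => (Set.Iic R).indicator log ‖w‖) := by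
      rw [integrable_fun_norm_addHaar volume (f := (Set.Iic R).indicator log)]
      have h2 : (fun y : ℝ => y ^ (Module.finrank ℝ E2 - 1) • (Set.Iic R).indicator log y)
          = (Set.Iic R).indicator (fun y => y * log y) := by
        ext y
        by_cases hy : y ∈ Set.Iic R <;> simp [hy]
      rw [h2, integrableOn_indicator_iff measurableSet_Iic]
      refine (continuous_mul_log.continuousOn.integrableOn_Icc (a := 0) (b := R)).mono_set ?_
      rintro y ⟨h1, h2⟩
      exact ⟨le_of_lt h2, h1⟩
    rw [← integrable_indicator_iff measurableSet_closedBall]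
    refine h.congr (.of_forall fun w => ?_)
    simp [Set.indicator]
  intro x
  refine ⟨closedBall 0 (‖x‖ + 1), ?_, key _⟩
  refine mem_of_superset (ball_mem_nhds x one_pos) fun y hy => ?_
  rw [mem_closedBall_zero_iff]
  rw [mem_ball_iff_norm] at hy
  linarith [norm_le_norm_add_norm_sub' y x]

lemma locallyIntegrable_comp_sub_right {φ : E2 → ℝ} (hφ : LocallyIntegrable φ) (y : E2) :
    LocallyIntegrable (fun x => φ (x - y)) := by
  intro x
  obtain ⟨U, hU, hUi⟩ := hφ (x - y)
  exact ⟨(fun z => z - y) ⁻¹' U, (continuous_id.sub continuous_const).continuousAt hU,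
    ((measurePreserving_sub_right volume y).integrableOn_comp_preimage
      (MeasurableEquiv.subRight y).measurableEmbedding).2 hUi⟩

/-- In polar coordinates, `|w|⁻²` over the annulus `r ≤ |w| ≤ R` integrates to a multiple of
`log (R / r)`. -/
lemma integral_inv_sq_norm_annulus {r R : ℝ} (hr : 0 < r) (hR : r ≤ R) :
    Integrable (fun w : E2 => (Set.Icc r R).indicator (fun s => (s ^ 2)⁻¹) ‖w‖) ∧
    ∫ w : E2, (Set.Icc r R).indicator (fun s => (s ^ 2)⁻¹) ‖w‖
      = 2 * volume.real (ball (0 : E2) 1) * log (R / r) := by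
  have h2 : (fun y : ℝ => y ^ (Module.finrank ℝ E2 - 1) •
      (Set.Icc r R).indicator (fun s : ℝ => (s ^ 2)⁻¹) y)
      = (Set.Icc r R).indicator (fun y => y⁻¹) := by
    ext y
    by_cases hy : y ∈ Set.Icc r R
    · have : y ≠ 0 := (hr.trans_le hy.1).ne'
      simp [hy]
      field_simp
    · simp [hy]
  have hsub : Set.Icc r R ∩ Set.Ioi 0 = Set.Icc r R :=
    Set.inter_eq_left.2 fun y hy => hr.trans_le hy.1
  constructor
  · rw [integrable_fun_norm_addHaar volume, h2, integrableOn_indicator_iff measurableSet_Icc, hsub]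
    exact (continuousOn_inv₀.mono fun y hy => (hr.trans_le hy.1).ne').integrableOn_Icc
  · rw [integral_fun_norm_addHaar volume, h2, setIntegral_indicator measurableSet_Icc,
      Set.inter_comm, hsub, integral_Icc_eq_integral_Ioc, ← intervalIntegral.integral_of_le hR,
      integral_inv_of_pos hr (hr.trans_le hR)]
    simp [mul_assoc]

/-- First-order Taylor expansion of the logarithmic potential. -/
lemma abs_log_norm_add_sub_le {w a : E2} (hw : 0 < ‖w‖) (ha : 2 * ‖a‖ ≤ ‖w‖) :
    |log ‖w + a‖ - log ‖w‖ - inner ℝ w a / ‖w‖ ^ 2| ≤ 13 * (‖a‖ ^ 2 / ‖w‖ ^ 2) := by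
  set t := ‖a‖ / ‖w‖ with ht
  have ht0 : 0 ≤ t := by positivity
  have ht1 : t ≤ 1 / 2 := by rw [ht, div_le_iff₀ hw]; linarith
  set q := inner ℝ w a / ‖w‖ ^ 2 with hq
  have hqt : |q| ≤ t := by
    rw [hq, abs_div, abs_of_pos (by positivity : 0 < ‖w‖ ^ 2), ht, div_le_div_iff₀ (by positivity) hw]
    nlinarith [abs_real_inner_le_norm w a]
  have hs : ‖w + a‖ ^ 2 = ‖w‖ ^ 2 * (1 + (2 * q + t ^ 2)) := by
    rw [norm_add_sq_real, hq, ht]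
    field_simp
    ring
  obtain ⟨hq1, hq2⟩ := abs_le.1 hqt
  set s := 2 * q + t ^ 2 with hsdef
  have hs4 : 1 / 4 ≤ 1 + s := by nlinarith
  have hlog : log ‖w + a‖ = log ‖w‖ + log (1 + s) / 2 := by
    have := congrArg log hs
    rw [log_mul (by positivity) (by positivity), log_pow, log_pow] at this
    push_cast at this
    linarith
  have hup : log (1 + s) ≤ s := by linarith [log_le_sub_one_of_pos (by linarith : 0 < 1 + s)]
  have hlo : s - 4 * s ^ 2 ≤ log (1 + s) := by
    refine le_trans ?_ (one_sub_inv_le_log_of_pos (by linarith : 0 < 1 + s))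
    have : (1 + s)⁻¹ ≤ 1 - s + 4 * s ^ 2 := by
      rw [inv_eq_one_div, div_le_iff₀ (by linarith)]
      nlinarith [mul_nonneg (sq_nonneg s) (by linarith : 0 ≤ 3 + 4 * s)]
    linarith
  have hss : s ^ 2 ≤ (5 / 2 * t) ^ 2 := by
    apply sq_le_sq'
    · nlinarith
    · nlinarith
  rw [← div_pow, ← ht, hlog, abs_le]
  constructor <;> nlinarith

/-- Since the first-order terms cancel, the potential of `μ` and that of a unit point mass at its
barycentre differ by `O(|w|⁻²)` away from the origin. -/
lemma abs_log_norm_add_sub_integral_le {l : ℝ} (hl : 0 < l) {μ : Measure E2}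
    [IsProbabilityMeasure μ] (hμ : μ (closedBall (0 : E2) l)ᶜ = 0) {w : E2} (hw : 2 * l ≤ ‖w‖) :
    |log ‖w + ∫ a, a ∂μ‖ - ∫ a, log ‖w + a‖ ∂μ| ≤ 26 * l ^ 2 * (‖w‖ ^ 2)⁻¹ := by
  have hw0 : 0 < ‖w‖ := by linarith
  have hae : ∀ᵐ a ∂μ, ‖a‖ ≤ l := by
    filter_upwards [measure_eq_zero_iff_ae_notMem.1 hμ] with a ha
    simpa using ha
  have hid : Integrable (fun a : E2 => a) μ :=
    Integrable.of_bound aestronglyMeasurable_id l hae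
  have hτ : ‖∫ a, a ∂μ‖ ≤ l := by
    simpa using norm_integral_le_of_norm_le_const hae
  have hrem : ∀ a : E2, ‖a‖ ≤ l →
      |log ‖w + a‖ - log ‖w‖ - inner ℝ w a / ‖w‖ ^ 2| ≤ 13 * l ^ 2 * (‖w‖ ^ 2)⁻¹ := by
    intro a ha
    refine (abs_log_norm_add_sub_le hw0 (by linarith)).trans ?_
    rw [div_eq_mul_inv, ← mul_assoc]
    gcongr
  set r : E2 → ℝ := fun a => log ‖w + a‖ - log ‖w‖ - inner ℝ w a / ‖w‖ ^ 2 with hr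
  have hrm : AEStronglyMeasurable r μ := by
    apply Measurable.aestronglyMeasurable
    fun_prop
  have hri : Integrable r μ := Integrable.of_bound hrm _ (hae.mono hrem)
  have hin : Integrable (fun a => inner ℝ w a) μ := hid.const_inner w
  have hint : ∫ a, log ‖w + a‖ ∂μ
      = ∫ a, r a ∂μ + (log ‖w‖ + inner ℝ w (∫ a, a ∂μ) / ‖w‖ ^ 2) := by
    have : (fun a => log ‖w + a‖) = fun a => r a + (log ‖w‖ + inner ℝ w a / ‖w‖ ^ 2) := by
      ext a; simp only [hr]; ring
    have hin' := hin.div_const (‖w‖ ^ 2)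
    have hsum : Integrable (fun a => log ‖w‖ + inner ℝ w a / ‖w‖ ^ 2) μ :=
      (integrable_const _).add hin'
    rw [this, integral_add hri hsum, integral_add (integrable_const _) hin', integral_div,
      integral_inner hid]
    simp
  have h1 : |∫ a, r a ∂μ| ≤ 13 * l ^ 2 * (‖w‖ ^ 2)⁻¹ := by
    simpa using norm_integral_le_of_norm_le_const (f := r) (hae.mono hrem)
  have h2 := hrem _ hτ
  rw [hint]
  rw [abs_le] at *
  constructor <;> linarith [h1.1, h1.2, h2.1, h2.2]

lemma volume_box (p : E2) (r : Fin 2 → ℝ) :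
    volume {y : E2 | ∀ i, |y i - p i| ≤ r i} = ∏ i, ENNReal.ofReal (2 * r i) := by
  have : {y : E2 | ∀ i, |y i - p i| ≤ r i} =
      WithLp.ofLp ⁻¹' (Set.Icc (fun i => p i - r i) (fun i => p i + r i)) := by
    ext y
    simp only [Set.mem_ofPred_eq, Set.mem_preimage, Set.mem_Icc, Pi.le_def, ← forall_and, abs_le]
    refine forall_congr' fun i => ⟨fun h => ⟨by linarith [h.1], by linarith [h.2]⟩,
      fun h => ⟨by linarith [h.1], by linarith [h.2]⟩⟩
  rw [this, (PiLp.volume_preserving_ofLp (Fin 2)).measure_preimage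
    measurableSet_Icc.nullMeasurableSet, Real.volume_Icc_pi]
  congr 1 with i
  ring_nf

lemma integrable_prod_add {μ : Measure E2} [IsFiniteMeasure μ] {g : E2 → ℝ} (hg : Integrable g) :
    Integrable (fun p : E2 × E2 => g (p.1 + p.2)) (μ.prod volume) :=
  (measurePreserving_prod_add μ volume).integrable_comp_of_integrable (hg.comp_snd μ)

lemma integral_integral_comp_add {μ : Measure E2} [IsProbabilityMeasure μ] {g : E2 → ℝ}
    (hg : Integrable g) : ∫ w, ∫ a, g (a + w) ∂μ = ∫ w, g w := by
  rw [integral_integral_swap (f := fun w a => g (a + w)) (integrable_prod_add hg).swap]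
  simp [integral_add_left_eq_self]

lemma integrable_mul_indicator_sub {φ : E2 → ℝ} (hφ : LocallyIntegrable φ) {A : Set E2}
    (hA : MeasurableSet A) (hb : IsBounded A) {l : ℝ} {μ : Measure E2} [IsProbabilityMeasure μ]
    (hμ : ∀ᵐ a ∂μ, ‖a‖ ≤ l) :
    Integrable (fun p : E2 × E2 => φ p.2 * A.indicator (fun _ => (1 : ℝ)) (p.2 - p.1))
      (μ.prod volume) := by
  obtain ⟨R, hR⟩ := hb.subset_closedBall (0 : E2)
  have hint : Integrable ((closedBall (0 : E2) (R + l)).indicator φ) :=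
    (hφ.integrableOn_isCompact (isCompact_closedBall _ _)).integrable_indicator
      measurableSet_closedBall
  refine (hint.comp_snd μ).mono ?_ ?_
  · refine hφ.aestronglyMeasurable.comp_snd.mul ?_
    apply Measurable.aestronglyMeasurable
    exact (measurable_const.indicator hA).comp (measurable_snd.sub measurable_fst)
  · filter_upwards [Measure.quasiMeasurePreserving_fst.ae hμ] with p hp
    by_cases h : p.2 - p.1 ∈ A
    · have : p.2 ∈ closedBall (0 : E2) (R + l) := by
        have h1 := hR h
        rw [mem_closedBall_zero_iff] at h1 ⊢
        linarith [norm_le_norm_add_norm_sub' p.2 p.1]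
      simp [h, Set.indicator_of_mem this]
    · simp [h]

lemma integral_indicator_sub_eq_measure {μ : Measure E2} {A : Set E2} (hA : MeasurableSet A) (x : E2) :
    ∫ a, A.indicator (fun _ => (1 : ℝ)) (x - a) ∂μ = (μ {a : E2 | x - a ∈ A}).toReal := by
  have hm : MeasurableSet {a : E2 | x - a ∈ A} := (measurable_const.sub measurable_id) hA
  have : (fun a => A.indicator (fun _ => (1 : ℝ)) (x - a))
      = {a : E2 | x - a ∈ A}.indicator (fun _ => (1 : ℝ)) := rfl
  rw [this, integral_indicator hm]
  simp [measureReal_def]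

lemma integral_mul_indicator_sub_measure {φ : E2 → ℝ} (hφ : LocallyIntegrable φ) {A : Set E2}
    (hA : MeasurableSet A) (hb : IsBounded A) {l : ℝ} {μ : Measure E2} [IsProbabilityMeasure μ]
    (hμ : ∀ᵐ a ∂μ, ‖a‖ ≤ l) (t : E2) :
    ∫ x, φ x * (((fun p => p + t) '' A).indicator (fun _ => (1 : ℝ)) x
        - (μ {a : E2 | x - a ∈ A}).toReal)
      = ∫ z in A, (φ (z + t) - ∫ a, φ (z + a) ∂μ) := by
  set F : E2 × E2 → ℝ := fun p => φ p.2 * A.indicator (fun _ => (1 : ℝ)) (p.2 - p.1) with hF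
  have hFi : Integrable F (μ.prod volume) := integrable_mul_indicator_sub hφ hA hb hμ
  have hGi : Integrable (fun p : E2 × E2 => F (p.1, p.1 + p.2)) (μ.prod volume) :=
    (measurePreserving_prod_add μ volume).integrable_comp_of_integrable hFi
  have ht : Integrable (fun x => φ x * A.indicator (fun _ => (1 : ℝ)) (x - t)) := by
    have := integrable_mul_indicator_sub hφ hA hb (l := ‖t‖) (μ := Measure.dirac t)
      (by simp [ae_dirac_eq])
    rw [Measure.dirac_prod] at this
    exact (integrable_map_measure this.aestronglyMeasurable (by fun_prop)).1 this
  have hind : ∀ x, ((fun p => p + t) '' A).indicator (fun _ => (1 : ℝ)) x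
      = A.indicator (fun _ => (1 : ℝ)) (x - t) := by
    intro x
    rw [Set.image_add_right]
    simp [Set.indicator, Set.mem_preimage, sub_eq_add_neg]
    rfl
  have hmul : ∀ x, φ x * (μ {a : E2 | x - a ∈ A}).toReal = ∫ a, F (a, x) ∂μ := by
    intro x
    rw [← integral_indicator_sub_eq_measure hA, ← integral_const_mul]
  have hG : ∀ a z, F (a, a + z) = A.indicator (fun z => φ (z + a)) z := by
    intro a z
    by_cases h : z ∈ A <;> simp [hF, h, add_comm]
  have hfst : ∫ x, φ x * A.indicator (fun _ => (1 : ℝ)) (x - t)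
      = ∫ z, A.indicator (fun z => φ (z + t)) z := by
    rw [← integral_add_left_eq_self _ t]
    exact integral_congr_ae (.of_forall fun z => hG t z)
  have hti : Integrable (A.indicator (fun z => φ (z + t))) := by
    have := ht.comp_add_left t
    exact this.congr (.of_forall fun z => hG t z)
  have hsnd : ∫ x, ∫ a, F (a, x) ∂μ = ∫ z, ∫ a, F (a, a + z) ∂μ := by
    rw [integral_integral_swap (f := fun x a => F (a, x)) hFi.swap,
      integral_integral_swap (f := fun z a => F (a, a + z)) hGi.swap]
    congr 1 with a
    exact (integral_add_left_eq_self (fun x => F (a, x)) a).symm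
  have hμi : ∀ z, ∫ a, F (a, a + z) ∂μ = A.indicator (fun z => ∫ a, φ (z + a) ∂μ) z := by
    intro z
    simp_rw [hG]
    by_cases h : z ∈ A <;> simp [h]
  have hsi : Integrable (A.indicator (fun z => ∫ a, φ (z + a) ∂μ)) := by
    refine hGi.integral_prod_right.congr (.of_forall hμi)
  have hFx : Integrable fun x => ∫ a, F (a, x) ∂μ := hFi.integral_prod_right
  simp_rw [hind, mul_sub, hmul]
  rw [integral_sub ht hFx, hfst, hsnd]
  simp_rw [hμi]
  rw [← integral_sub hti hsi, ← integral_indicator hA]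
  congr 1 with z
  by_cases h : z ∈ A <;> simp [h]

lemma exists_setIntegral_log_kernel_le {l : ℝ} (hl : 0 < l) :
    ∃ M : ℝ, 0 ≤ M ∧ ∀ μ : Measure E2, IsProbabilityMeasure μ → μ (closedBall (0 : E2) l)ᶜ = 0 →
      ∀ R, 2 * l ≤ R → ∀ A : Set E2, MeasurableSet A → ∀ y : E2, A ⊆ closedBall y R →
      |∫ z in A, (log ‖z - y + ∫ a, a ∂μ‖ - ∫ a, log ‖z - y + a‖ ∂μ)|
        ≤ M * (1 + log (R / (2 * l))) := by
  set G : E2 → ℝ := (closedBall (0 : E2) (3 * l)).indicator (fun w => |log ‖w‖|) with hGdef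
  have hGi : Integrable G :=
    IntegrableOn.integrable_indicator (locallyIntegrable_log_norm.integrableOn_isCompact
      (isCompact_closedBall _ _)).abs measurableSet_closedBall
  have hG0 : ∀ w, 0 ≤ G w := fun w => Set.indicator_nonneg (fun _ _ => abs_nonneg _) _
  set V := volume.real (ball (0 : E2) 1)
  refine ⟨2 * (∫ w, G w) + 26 * l ^ 2 * (2 * V), ?_, ?_⟩
  · have : 0 ≤ ∫ w, G w := integral_nonneg hG0
    positivity
  intro μ _ hμ R hR A hA y hAy
  have hae : ∀ᵐ a ∂μ, ‖a‖ ≤ l := by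
    filter_upwards [measure_eq_zero_iff_ae_notMem.1 hμ] with a ha
    simpa using ha
  set τ := ∫ a, a ∂μ with hτdef
  have hτ : ‖τ‖ ≤ l := by
    simpa using norm_integral_le_of_norm_le_const hae
  obtain ⟨hHi, hHv⟩ := integral_inv_sq_norm_annulus (by positivity : 0 < 2 * l) hR
  set H : E2 → ℝ := fun w => (Set.Icc (2 * l) R).indicator (fun s => (s ^ 2)⁻¹) ‖w‖ with hHdef
  have hH0 : ∀ w, 0 ≤ H w := fun w => Set.indicator_nonneg (fun _ _ => by positivity) _
  set D : E2 → ℝ := fun w => G (τ + w) + ∫ a, G (a + w) ∂μ + 26 * l ^ 2 * H w with hD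
  have hGτ : Integrable fun w => G (τ + w) := hGi.comp_add_left τ
  have hGμ : Integrable fun w => ∫ a, G (a + w) ∂μ := (integrable_prod_add hGi).integral_prod_right
  have hDi : Integrable D := (hGτ.add hGμ).add (hHi.const_mul _)
  have hD0 : ∀ w, 0 ≤ D w := fun w =>
    add_nonneg (add_nonneg (hG0 _) (integral_nonneg fun _ => hG0 _)) (by have := hH0 w; positivity)
  have hDv : ∫ w, D w = 2 * (∫ w, G w) + 26 * l ^ 2 * (2 * V * log (R / (2 * l))) := by
    have hGG : Integrable fun w => G (τ + w) + ∫ a, G (a + w) ∂μ := hGτ.add hGμ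
    rw [hD, integral_add hGG (hHi.const_mul _), integral_add hGτ hGμ,
      integral_const_mul, hHv, integral_integral_comp_add hGi, integral_add_left_eq_self]
    ring
  have hdom : ∀ w : E2, ‖w‖ ≤ R → |log ‖w + τ‖ - ∫ a, log ‖w + a‖ ∂μ| ≤ D w := by
    intro w hw
    rcases le_or_gt (2 * l) ‖w‖ with h | h
    · have : H w = (‖w‖ ^ 2)⁻¹ := Set.indicator_of_mem (Set.mem_Icc.2 ⟨h, hw⟩) _
      have h1 := abs_log_norm_add_sub_integral_le hl hμ h
      rw [← this] at h1
      exact h1.trans (le_add_of_nonneg_left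
        (add_nonneg (hG0 _) (integral_nonneg fun _ => hG0 _)))
    · have hGeq : ∀ a : E2, ‖a‖ ≤ l → |log ‖w + a‖| = G (a + w) := by
        intro a ha
        have : a + w ∈ closedBall (0 : E2) (3 * l) := by
          rw [mem_closedBall_zero_iff]
          linarith [norm_add_le a w]
        rw [hGdef, Set.indicator_of_mem this, add_comm]
      have h1 : |∫ a, log ‖w + a‖ ∂μ| ≤ ∫ a, G (a + w) ∂μ := by
        refine (norm_integral_le_integral_norm (fun a => log ‖w + a‖)).trans_eq ?_
        exact integral_congr_ae (hae.mono hGeq)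
      calc _ ≤ |log ‖w + τ‖| + |∫ a, log ‖w + a‖ ∂μ| := abs_sub _ _
        _ ≤ G (τ + w) + ∫ a, G (a + w) ∂μ := add_le_add (hGeq _ hτ).le h1
        _ ≤ D w := le_add_of_nonneg_right (by have := hH0 w; positivity)
  calc _ ≤ ∫ z in A, D (z - y) := by
        refine norm_integral_le_of_norm_le (f := fun z => log ‖z - y + τ‖ - ∫ a, log ‖z - y + a‖ ∂μ)
          (hDi.comp_sub_right y).integrableOn ?_
        refine (ae_restrict_iff' hA).2 (.of_forall fun z hz => hdom _ ?_)
        simpa [mem_closedBall, dist_eq_norm] using hAy hz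
    _ ≤ ∫ z, D (z - y) := setIntegral_le_integral (hDi.comp_sub_right y)
        (.of_forall fun z => hD0 _)
    _ = ∫ w, D w := integral_sub_right_eq_self D y
    _ ≤ _ := by
      rw [hDv]
      have h1 : 0 ≤ ∫ w, G w := integral_nonneg hG0
      have h2 : 0 ≤ log (R / (2 * l)) := log_nonneg (by rw [le_div_iff₀ (by positivity)]; linarith)
      have hV : 0 ≤ V := measureReal_nonneg
      nlinarith [mul_nonneg h1 h2, mul_nonneg (sq_nonneg l) hV]

lemma dist_le_two_mul_of_forall_abs_sub_le {y c : E2} {r : ℝ} (hr : 0 ≤ r)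
    (h : ∀ i, |y i - c i| ≤ r) : dist y c ≤ 2 * r := by
  rw [EuclideanSpace.dist_eq]
  refine Real.sqrt_le_iff.2 ⟨by positivity, ?_⟩
  have h2 : ∀ i, dist (y i) (c i) ^ 2 ≤ r ^ 2 := fun i => by
    rw [Real.dist_eq]
    exact pow_le_pow_left₀ (abs_nonneg _) (h i) 2
  rw [Fin.sum_univ_two]
  nlinarith [h2 0, h2 1, sq_nonneg r]

/-- The open axis-parallel square with centre `c` and side `s`. -/
def openSquare (c : E2) (s : ℝ) : Set E2 := {x : E2 | ∀ i, |x i - c i| < s / 2}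

lemma isOpen_openSquare_s15 (c : E2) (s : ℝ) : IsOpen (openSquare c s) := by
  simp only [openSquare, Set.ofPred_forall]
  exact isOpen_iInter_of_finite fun i => isOpen_lt (by fun_prop) continuous_const

lemma openSquare_subset_closedBall {c : E2} {s : ℝ} (hs : 0 < s) :
    openSquare c s ⊆ closedBall c s := by
  intro x hx
  have := dist_le_two_mul_of_forall_abs_sub_le (by positivity : 0 ≤ s / 2)
    (fun i => (hx i).le)
  rw [mem_closedBall]
  linarith

lemma side_le_of_volume_le {c : E2} {s v : ℝ} (hv : 0 ≤ v)
    (h : volume (openSquare c s) ≤ ENNReal.ofReal v) : s ≤ √v := by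
  refine le_of_forall_lt_imp_le_of_dense fun r hr => ?_
  rcases le_or_gt r 0 with hr0 | hr0
  · exact hr0.trans (Real.sqrt_nonneg _)
  have h1 : {y : E2 | ∀ i, |y i - c i| ≤ (fun _ : Fin 2 => r / 2) i} ⊆ openSquare c s :=
    fun y hy i => (hy i).trans_lt (by simp only; linarith)
  have h2 := (measure_mono h1).trans h
  rw [volume_box, Fin.prod_univ_two, ← ENNReal.ofReal_mul (by positivity),
    ENNReal.ofReal_le_ofReal_iff hv] at h2
  exact Real.le_sqrt_of_sq_le (by nlinarith)

lemma exists_mem_frontier_openSquare {c : E2} {s : ℝ} (hs : 0 < s) (y : E2) :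
    ∃ p : E2, infDist y (frontier (openSquare c s)) = dist y p ∧
      (∀ i, |p i - c i| ≤ s / 2) ∧ ∃ i, |p i - c i| = s / 2 := by
  have hne : (frontier (openSquare c s)).Nonempty := by
    rw [nonempty_frontier_iff]
    refine ⟨⟨c, fun i => by simpa using hs⟩, fun h => ?_⟩
    have h1 : c + EuclideanSpace.single 0 s ∈ openSquare c s := h ▸ Set.mem_univ _
    have h2 := h1 0
    simp only [PiLp.add_apply, PiLp.single_apply, if_true, add_sub_cancel_left,
      abs_of_pos hs] at h2
    linarith
  obtain ⟨p, hp, hdist⟩ := isClosed_frontier.exists_infDist_eq_dist hne y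
  have hcl : closure (openSquare c s) ⊆ {x : E2 | ∀ i, |x i - c i| ≤ s / 2} := by
    refine closure_minimal (fun x hx i => (hx i).le) ?_
    simp only [Set.ofPred_forall]
    exact isClosed_iInter fun i => isClosed_le (by fun_prop) continuous_const
  have hp1 := hcl hp.1
  refine ⟨p, hdist, hp1, ?_⟩
  by_contra! hcon
  refine hp.2 ?_
  rw [(isOpen_openSquare_s15 c s).interior_eq]
  exact fun i => lt_of_le_of_ne (hp1 i) (hcon i)

lemma abs_sub_le_of_infDist_frontier_le {c : E2} {s l : ℝ} (hs : 0 < s) {y : E2}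
    (hy : infDist y (frontier (openSquare c s)) ≤ l) :
    (∀ i, |y i - c i| ≤ s / 2 + l) ∧
      ∃ i, |y i - (c i + s / 2)| ≤ l ∨ |y i - (c i + -(s / 2))| ≤ l := by
  obtain ⟨p, hd, hp, i, hi⟩ := exists_mem_frontier_openSquare (c := c) hs y
  have hyp : ∀ j, |y j - p j| ≤ l := by
    intro j
    have := PiLp.norm_apply_le (y - p) j
    rw [← dist_eq_norm] at this
    exact this.trans (hd ▸ hy)
  refine ⟨fun j => ?_, i, ?_⟩
  · have := abs_sub_le (y j) (p j) (c j)
    linarith [hyp j, hp j]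
  · rcases (abs_eq (by positivity)).1 hi with h | h
    · left
      convert hyp i using 2
      linarith
    · right
      convert hyp i using 2
      linarith

lemma volume_strip_le {c : E2} {s l : ℝ} (hs : 0 < s) (hl : 0 < l) :
    volume {y : E2 | infDist y (frontier (openSquare c s)) ≤ l}
      ≤ ENNReal.ofReal (8 * l * (s + 2 * l)) := by
  set S : Fin 2 → ℝ → Set E2 := fun i t => {y : E2 | ∀ j, |y j - (c + EuclideanSpace.single i t) j|
    ≤ (fun j => if j = i then l else s / 2 + l) j} with hS
  have hvol : ∀ i t, volume (S i t) = ENNReal.ofReal (2 * l * (s + 2 * l)) := by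
    intro i t
    rw [hS, volume_box, Fin.prod_univ_two, ← ENNReal.ofReal_mul (by split_ifs <;> positivity)]
    congr 1
    fin_cases i <;> simp only [Fin.zero_eta, Fin.mk_one, if_true, zero_ne_one, one_ne_zero, if_false] <;>
      ring
  have hsub : {y : E2 | infDist y (frontier (openSquare c s)) ≤ l}
      ⊆ ⋃ i, (S i (s / 2) ∪ S i (-(s / 2))) := by
    intro y hy
    obtain ⟨h1, i, h2⟩ := abs_sub_le_of_infDist_frontier_le hs hy
    refine Set.mem_iUnion.2 ⟨i, h2.imp (fun h j => ?_) (fun h j => ?_)⟩ <;>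
    · by_cases hj : j = i
      · subst hj
        simpa using h
      · simpa [hj] using h1 j
  calc _ ≤ ∑ i, volume (S i (s / 2) ∪ S i (-(s / 2))) :=
        (measure_mono hsub).trans (measure_iUnion_fintype_le _ _)
    _ ≤ ∑ i : Fin 2, (ENNReal.ofReal (2 * l * (s + 2 * l)) + ENNReal.ofReal (2 * l * (s + 2 * l))) :=
        Finset.sum_le_sum fun i _ => (measure_union_le _ _).trans_eq (by rw [hvol, hvol])
    _ = _ := by
      rw [← ENNReal.ofReal_add (by positivity) (by positivity), Fin.sum_univ_two,
        ← ENNReal.ofReal_add (by positivity) (by positivity)]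
      congr 1
      ring

lemma integrable_log_norm_sub_mul_mul {f b : E2 → ℝ} (hf : Measurable f) (hb : Measurable b)
    {C C' r r' : ℝ} {c : E2} (hfC : ∀ x, |f x| ≤ C) (hbC : ∀ y, |b y| ≤ C')
    (hf0 : ∀ x, x ∉ closedBall c r → f x = 0) (hb0 : ∀ y, y ∉ closedBall c r' → b y = 0) :
    Integrable (fun p : E2 × E2 => -log ‖p.1 - p.2‖ * f p.1 * b p.2) (volume.prod volume) := by
  have hC : 0 ≤ C := (abs_nonneg _).trans (hfC 0)
  have hG : Integrable ((closedBall (0 : E2) (r + r')).indicator (fun w => log ‖w‖)) :=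
    (locallyIntegrable_log_norm.integrableOn_isCompact
      (isCompact_closedBall _ _)).integrable_indicator measurableSet_closedBall
  have hI : Integrable ((closedBall c r').indicator (fun _ : E2 => C * C')) :=
    (integrableOn_const measure_closedBall_lt_top.ne).integrable_indicator measurableSet_closedBall
  refine (hI.convolution_integrand (ContinuousLinearMap.mul ℝ ℝ) hG).mono ?_ ?_
  · apply Measurable.aestronglyMeasurable
    fun_prop
  · refine .of_forall fun p => ?_
    by_cases h1 : p.1 ∈ closedBall c r
    · by_cases h2 : p.2 ∈ closedBall c r'
      · have h3 : p.1 - p.2 ∈ closedBall (0 : E2) (r + r') := by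
          rw [mem_closedBall_zero_iff, ← dist_eq_norm]
          rw [mem_closedBall] at h1 h2
          linarith [dist_triangle_right p.1 p.2 c]
        simp only [ContinuousLinearMap.mul_apply', Set.indicator_of_mem h2,
          Set.indicator_of_mem h3, norm_mul, norm_neg, Real.norm_eq_abs, abs_of_nonneg hC]
        calc _ ≤ |log ‖p.1 - p.2‖| * C * |C'| := by
              have := hfC p.1
              have := (hbC p.2).trans (le_abs_self C')
              gcongr
          _ = _ := by ring
      · rw [hb0 _ h2, mul_zero, norm_zero]
        exact norm_nonneg _
    · rw [hf0 _ h1, mul_zero, zero_mul, norm_zero]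
      exact norm_nonneg _

lemma measurable_measure_setOf_sub_mem (μ : Measure E2) [SFinite μ] {A : Set E2}
    (hA : MeasurableSet A) : Measurable fun x => μ {a : E2 | x - a ∈ A} :=
  measurable_measure_prodMk_left (s := {p : E2 × E2 | p.1 - p.2 ∈ A})
    ((measurable_fst.sub measurable_snd) hA)

lemma abs_indicator_sub_measure_le (μ : Measure E2) [IsProbabilityMeasure μ] (S A : Set E2)
    (x : E2) : |S.indicator (fun _ => (1 : ℝ)) x - (μ {a : E2 | x - a ∈ A}).toReal| ≤ 1 := by
  have h1 : (μ {a : E2 | x - a ∈ A}).toReal ≤ 1 := measureReal_le_one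
  have h2 : 0 ≤ (μ {a : E2 | x - a ∈ A}).toReal := ENNReal.toReal_nonneg
  by_cases h : x ∈ S <;> simp only [h, Set.indicator_of_mem, not_false_eq_true,
    Set.indicator_of_notMem] <;> rw [abs_le] <;> constructor <;> linarith

lemma indicator_sub_measure_eq_zero {μ : Measure E2} {l r : ℝ} {t c : E2} (ht : ‖t‖ ≤ l)
    (hμ : μ (closedBall (0 : E2) l)ᶜ = 0) {A : Set E2} (hA : A ⊆ closedBall c r) {x : E2}
    (hx : x ∉ closedBall c (r + l)) :
    ((fun p => p + t) '' A).indicator (fun _ => (1 : ℝ)) x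
      - (μ {a : E2 | x - a ∈ A}).toReal = 0 := by
  have key : ∀ a : E2, ‖a‖ ≤ l → x - a ∉ A := by
    intro a ha h
    refine hx ?_
    have h1 := hA h
    rw [mem_closedBall] at h1 ⊢
    have h2 : dist x (x - a) = ‖a‖ := by simp
    linarith [dist_triangle x (x - a) c]
  have h1 : x ∉ (fun p => p + t) '' A := by
    rintro ⟨p, hp, rfl⟩
    exact key t ht (by simpa using hp)
  have h2 : μ {a : E2 | x - a ∈ A} = 0 := by
    refine measure_mono_null ?_ hμ
    intro a ha h
    exact key a (mem_closedBall_zero_iff.1 h) ha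
  rw [Set.indicator_of_notMem h1, h2, ENNReal.toReal_zero, sub_zero]

/-- For a square `A` of area `O(N)`, a probability measure `μ` supported in `B_ℓ(0)`
with first moment `τ`, and a bounded function `b` supported in the boundary strip `B`
of `A` of width `ℓ`, `|D(1_{A+τ} − 1_A ∗ μ, b)| = O(N^{1/2} log N)`. -/
theorem dipole_boundary_bound (C₀ C₁ ℓ : ℝ) (hC₀ : 0 < C₀) (hC₁ : 0 < C₁) (hℓ : 0 < ℓ) :
    ∃ C : ℝ, 0 < C ∧ ∀ N : ℝ, 2 ≤ N → ∀ A : Set E2, IsSquareSet A →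
      volume A ≤ ENNReal.ofReal (C₀ * N) →
      ∀ μ : Measure E2, IsProbabilityMeasure μ →
        μ (Metric.closedBall (0 : E2) ℓ)ᶜ = 0 →
        ∀ b : E2 → ℝ, Measurable b → (∀ y, |b y| ≤ C₁) →
          (∀ y, y ∉ {y : E2 | Metric.infDist y (frontier A) ≤ ℓ} → b y = 0) →
          |Dpair
              (fun x => Set.indicator ((fun p => p + (∫ a : E2, a ∂μ)) '' A)
                  (fun _ => (1 : ℝ)) x
                - (μ {a : E2 | x - a ∈ A}).toReal)
              b|
            ≤ C * N ^ ((1 : ℝ) / 2) * Real.log N := by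
  obtain ⟨M, hM, hker⟩ := exists_setIntegral_log_kernel_le hℓ
  set κ : ℝ := (1 + log (√C₀ / ℓ + 1)) / log 2 + 1 / 2 with hκ
  have hlog2 : 0 < log 2 := log_pos one_lt_two
  have hlogκ : 0 ≤ log (√C₀ / ℓ + 1) := log_nonneg (by
    have : 0 ≤ √C₀ / ℓ := by positivity
    linarith)
  have hκ0 : 0 ≤ κ := by positivity
  refine ⟨1 / 2 * (C₁ * (M * κ) * (8 * ℓ * (√C₀ + 2 * ℓ))) + 1, by positivity, ?_⟩
  intro N hN A hA hvol μ _ hμ b hb hbC hb0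
  obtain ⟨c, s, hs, rfl⟩ := hA
  change volume (openSquare c s) ≤ _ at hvol
  change ∀ y, y ∉ {y : E2 | infDist y (frontier (openSquare c s)) ≤ ℓ} → b y = 0 at hb0
  set A := openSquare c s with hAdef
  set τ := ∫ a : E2, a ∂μ with hτdef
  have hN0 : 0 < N := by linarith
  have hsN : s ≤ √C₀ * √N := by
    rw [← Real.sqrt_mul hC₀.le]
    exact side_le_of_volume_le (by positivity) hvol
  have hN1 : 1 ≤ √N := Real.one_le_sqrt.2 (by linarith)
  have hae : ∀ᵐ a ∂μ, ‖a‖ ≤ ℓ := by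
    filter_upwards [measure_eq_zero_iff_ae_notMem.1 hμ] with a ha
    simpa using ha
  have hτ : ‖τ‖ ≤ ℓ := by
    simpa using norm_integral_le_of_norm_le_const hae
  have hAm : MeasurableSet A := (isOpen_openSquare_s15 c s).measurableSet
  have hAc : A ⊆ closedBall c s := openSquare_subset_closedBall hs
  have hAb : IsBounded A := isBounded_closedBall.subset hAc
  set B := {y : E2 | infDist y (frontier A) ≤ ℓ} with hB
  have hBc : B ⊆ closedBall c (s + 2 * ℓ) := by
    intro y hy
    have := dist_le_two_mul_of_forall_abs_sub_le (by positivity)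
      (abs_sub_le_of_infDist_frontier_le hs hy).1
    rw [mem_closedBall]
    linarith
  have hBvol : volume B ≤ ENNReal.ofReal (8 * ℓ * (s + 2 * ℓ)) := volume_strip_le hs hℓ
  set f : E2 → ℝ := fun x => ((fun p => p + τ) '' A).indicator (fun _ => (1 : ℝ)) x
    - (μ {a : E2 | x - a ∈ A}).toReal with hf
  have hfm : Measurable f := by
    refine (measurable_const.indicator ?_).sub
      (measurable_measure_setOf_sub_mem μ hAm).ennreal_toReal
    rw [Set.image_add_right]
    exact (measurable_add_const (-τ)) hAm
  have hint : Integrable (fun p : E2 × E2 => -log ‖p.1 - p.2‖ * f p.1 * b p.2)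
      (volume.prod volume) :=
    integrable_log_norm_sub_mul_mul hfm hb (abs_indicator_sub_measure_le μ _ A) hbC
      (fun x hx => indicator_sub_measure_eq_zero hτ hμ hAc hx)
      (fun y hy => hb0 y fun h => hy (hBc h))
  set u : E2 → ℝ := fun y => ∫ x, log ‖x - y‖ * f x with hu
  have hu_le : ∀ y ∈ B, |u y| ≤ M * (κ * log N) := by
    intro y hy
    have h1 : u y = ∫ z in A, (log ‖z - y + τ‖ - ∫ a, log ‖z - y + a‖ ∂μ) := by
      have hφ : LocallyIntegrable (fun x : E2 => log ‖x - y‖) :=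
        locallyIntegrable_comp_sub_right locallyIntegrable_log_norm y
      rw [hu, hf]
      simp only
      rw [integral_mul_indicator_sub_measure hφ hAm hAb hae τ]
      simp only [sub_add_eq_add_sub]
    have h2 : A ⊆ closedBall y (2 * s + 2 * ℓ) := by
      intro z hz
      have h3 := hAc hz
      have h4 := hBc hy
      rw [mem_closedBall] at *
      linarith [dist_triangle_right z y c]
    rw [h1]
    refine (hker μ inferInstance hμ _ (by linarith) A hAm y h2).trans ?_
    gcongr
    have h5 : (2 * s + 2 * ℓ) / (2 * ℓ) ≤ (√C₀ / ℓ + 1) * √N := by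
      rw [div_le_iff₀ (by positivity)]
      have : (√C₀ / ℓ + 1) * √N * (2 * ℓ) = 2 * (√C₀ * √N) + 2 * ℓ * √N := by
        field_simp
      rw [this]
      nlinarith
    have h6 : log ((2 * s + 2 * ℓ) / (2 * ℓ)) ≤ log (√C₀ / ℓ + 1) + log N / 2 := by
      rw [← Real.log_sqrt hN0.le, ← log_mul (by positivity) (by positivity)]
      exact log_le_log (by positivity) h5
    have h7 : 1 + log (√C₀ / ℓ + 1) ≤ (1 + log (√C₀ / ℓ + 1)) / log 2 * log N := by
      rw [div_mul_eq_mul_div, le_div_iff₀ hlog2]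
      exact mul_le_mul_of_nonneg_left (log_le_log two_pos hN) (by positivity)
    rw [hκ]
    linarith
  have hD : Dpair f b = -(1 / 2 * ∫ y in B, b y * u y) := by
    have hswap := integral_integral_swap (f := fun x y => -log ‖x - y‖ * f x * b y) hint
    rw [Dpair, hswap, ← mul_neg, ← integral_neg,
      setIntegral_eq_integral_of_forall_compl_eq_zero fun y hy => by rw [hb0 y hy]; simp]
    congr 2 with y
    rw [hu]
    simp only
    rw [← integral_const_mul, ← integral_neg]
    congr 1 with x
    ring
  have hBfin : volume B < ∞ := hBvol.trans_lt ENNReal.ofReal_lt_top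
  have hlogN : 0 ≤ log N := log_nonneg (by linarith)
  have hbd : |∫ y in B, b y * u y| ≤ C₁ * (M * (κ * log N)) * (8 * ℓ * (s + 2 * ℓ)) := by
    have h1 := norm_setIntegral_le_of_norm_le_const (f := fun y => b y * u y)
      (C := C₁ * (M * (κ * log N))) hBfin fun y hy => by
        rw [norm_mul]
        exact mul_le_mul (hbC y) (hu_le y hy) (abs_nonneg _) hC₁.le
    refine h1.trans (mul_le_mul_of_nonneg_left ?_ (by positivity))
    exact ENNReal.toReal_le_of_le_ofReal (by positivity) hBvol
  change |Dpair f b| ≤ _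
  rw [hD, abs_neg, abs_mul, abs_of_pos (by norm_num : (0 : ℝ) < 1 / 2), ← Real.sqrt_eq_rpow]
  have hs2 : s + 2 * ℓ ≤ (√C₀ + 2 * ℓ) * √N := by nlinarith
  calc _ ≤ 1 / 2 * (C₁ * (M * (κ * log N)) * (8 * ℓ * ((√C₀ + 2 * ℓ) * √N))) := by
        refine mul_le_mul_of_nonneg_left (hbd.trans ?_) (by norm_num)
        gcongr
    _ = 1 / 2 * (C₁ * (M * κ) * (8 * ℓ * (√C₀ + 2 * ℓ))) * √N * log N := by ring
    _ ≤ _ := by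
      gcongr
      linarith
end
end
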